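/- Let w ∈ ℤ, n ≥ 1, m ≥ 0, l ≥ 0, let D = {z ∈ ℂ : |z| < ε} be an open disc and N a connected open neighborhood of 0 in ℂ^m × ℂ^l. Let C_1,…,C_m, F_1,…,F_l, U be holomorphic M_n(ℂ)-valued maps on D × N such that for every (t,y) ∈ N the matrices C_1(0,t,y),…,C_m(0,t,y), F_1(0,t,y),…,F_l(0,t,y), U(0,t,y) pairwise commute, and such that the generation condition holds for the matrices C_1(0,0,0),…,C_m(0,0,0), U(0,0,0) with some ζ ∈ ℂ^n. Let R be a holomorphic M_n(ℂ)-valued map on (D∖{0}) × N satisfying, for z ∈ D∖{0}: z ∂R/∂z (z,t,y) = z^{-1}( U(z,t,y)^T R(z,t,y) − R(z,t,y) U(−z,t,y) ), ∂R/∂t_i (z,t,y) = z^{-1}( C_i(z,t,y)^T R(z,t,y) − R(z,t,y) C_i(−z,t,y) ), and ∂R/∂y_α (z,t,y) = z^{-1}( F_α(z,t,y)^T R(z,t,y) − R(z,t,y) F_α(−z,t,y) ). Suppose that for each t with (t,0) ∈ N the function z ↦ z^{−w} R(z,t,0) extends holomorphically across z = 0. Then there exist a disc D' ⊆ D around 0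 and a neighborhood N' ⊆ N of 0 and a holomorphic map R̂ : D' × N' → M_n(ℂ) with R̂(z,t,y) = z^{−w} R(z,t,y) for all z ≠ 0; i.e. z^{−w}R extends holomorphically across z = 0 near the origin. -/

import Mathlib

/-!
Statement 5 (Lemma 3.2, matrix form): the Gram matrix `R` of a flat pairing on an
unfolding of a `(TEP(w))`-structure, divided by `z^w`, extends holomorphically
across `z = 0` near the origin, provided it does so at `y = 0` and the generation
condition holds.
-/

noncomputable section

/-- `n × n` complex matrices. -/
abbrev Mat (n : ℕ) := Matrix (Fin n) (Fin n) ℂ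

/-- The commutator `[A,B] = A*B - B*A`. -/
def matComm {n : ℕ} (A B : Mat n) : Mat n := A * B - B * A

/-- Entrywise holomorphy of a matrix-valued map on a set. -/
def MDiffOn {E : Type*} [NormedAddCommGroup E] [NormedSpace ℂ E] {n : ℕ}
    (f : E → Mat n) (s : Set E) : Prop :=
  ∀ k j, DifferentiableOn ℂ (fun q => f q k j) s

/-- Entrywise partial derivative of a matrix-valued map at `p` in direction `v`. -/
def mpderiv {E : Type*} [NormedAddCommGroup E] [NormedSpace ℂ E] {n : ℕ}
    (f : E → Mat n) (p v : E) : Mat n :=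
  Matrix.of fun k j => fderiv ℂ (fun q => f q k j) p v

/-- Generation condition: `ζ` together with all vectors obtained from `ζ` by finitely
many successive applications of the matrices `B i` spans `ℂ^n`. -/
def GenCond {n r : ℕ} (B : Fin r → Mat n) (ζ : Fin n → ℂ) : Prop :=
  Submodule.span ℂ
    {v : Fin n → ℂ | ∃ L : List (Fin r), v = Matrix.mulVec (L.map B).prod ζ} = ⊤

/-- Points of `ℂ × ℂ^m × ℂ^l` with coordinates `(z, t, y)`. -/
abbrev PtZ (m l : ℕ) := ℂ × (Fin m → ℂ) × (Fin l → ℂ)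

section HolomorphicExtension

open Metric Set Filter Topology

section Analysis

variable {X E V : Type*} [NormedAddCommGroup X] [NormedSpace ℂ X]
  [NormedAddCommGroup E] [NormedSpace ℂ E] [NormedAddCommGroup V] [NormedSpace ℂ V]

theorem exists_eventually_forall_norm_le_of_continuousOn {X E : Type*} [NormedAddCommGroup X]
    [ProperSpace X] [NormedAddCommGroup E] {K : Set ℂ}
    (hK : IsCompact K) {O : Set X} (hO : IsOpen O) {f : ℂ → X → E}
    (hf : ContinuousOn (Function.uncurry f) (K ×ˢ O)) {x : X} (hx : x ∈ O) :
    ∃ M, 0 ≤ M ∧ ∀ᶠ x' in 𝓝 x, ∀ z ∈ K, ‖f z x'‖ ≤ M := by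
  obtain ⟨r, hr, hrO⟩ := nhds_basis_closedBall.mem_iff.1 (hO.mem_nhds hx)
  obtain ⟨M, hM⟩ := (hK.prod (isCompact_closedBall x r)).exists_bound_of_continuousOn
    (hf.mono (prod_mono_right hrO))
  refine ⟨|M|, abs_nonneg M, ?_⟩
  filter_upwards [closedBall_mem_nhds x hr] with x' hx' z hz
  exact (hM (z, x') ⟨hz, hx'⟩).trans (le_abs_self M)

theorem circleMap_zero_mem_sphere {ρ : ℝ} (hρ : 0 ≤ ρ) (θ : ℝ) :
    circleMap 0 ρ θ ∈ sphere (0 : ℂ) ρ :=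
  circleMap_mem_sphere 0 hρ θ

theorem continuous_circleIntegrand {ρ : ℝ} (hρ : 0 ≤ ρ) {f : ℂ → E}
    (hf : ContinuousOn f (sphere 0 ρ)) :
    Continuous fun θ : ℝ => deriv (circleMap 0 ρ) θ • f (circleMap 0 ρ θ) := by
  have h : Continuous fun θ : ℝ => f (circleMap 0 ρ θ) :=
    hf.comp_continuous (continuous_circleMap 0 ρ) (circleMap_zero_mem_sphere hρ)
  simp only [deriv_circleMap]
  exact ((continuous_circleMap 0 ρ).mul continuous_const).smul h

/-- Differentiation under the integral sign for circle integrals. -/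
theorem hasFDerivAt_circleIntegral [ProperSpace X] {O : Set X} (hO : IsOpen O) {ρ : ℝ}
    (hρ : 0 ≤ ρ) {f : ℂ → X → E} {f' : ℂ → X → X →L[ℂ] E}
    (hf : ContinuousOn (Function.uncurry f) (sphere 0 ρ ×ˢ O))
    (hf' : ContinuousOn (Function.uncurry f') (sphere 0 ρ ×ˢ O))
    (h : ∀ z ∈ sphere (0 : ℂ) ρ, ∀ x ∈ O, HasFDerivAt (f z) (f' z x) x) {x : X} (hx : x ∈ O) :
    HasFDerivAt (fun x => ∮ z in C(0, ρ), f z x) (∮ z in C(0, ρ), f' z x) x := by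
  obtain ⟨M, hM0, hM⟩ :=
    exists_eventually_forall_norm_le_of_continuousOn (isCompact_sphere 0 ρ) hO hf' hx
  refine intervalIntegral.hasFDerivAt_integral_of_dominated_of_fderiv_le
    (F' := fun y θ => deriv (circleMap 0 ρ) θ • f' (circleMap 0 ρ θ) y)
    (bound := fun _ => ρ * M) (inter_mem (hO.mem_nhds hx) hM) ?_
    ((continuous_circleIntegrand hρ (hf.uncurry_right x hx)).intervalIntegrable _ _)
    (continuous_circleIntegrand hρ (hf'.uncurry_right x hx)).aestronglyMeasurable ?_
    intervalIntegrable_const ?_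
  · filter_upwards [hO.mem_nhds hx] with y hy
    exact (continuous_circleIntegrand hρ (hf.uncurry_right y hy)).aestronglyMeasurable
  · refine .of_forall fun θ _ y hy => ?_
    rw [norm_smul]
    have : ‖deriv (circleMap 0 ρ) θ‖ = ρ := by simp [abs_of_nonneg hρ]
    rw [this]
    exact mul_le_mul_of_nonneg_left (hy.2 _ (circleMap_zero_mem_sphere hρ θ)) hρ
  · exact .of_forall fun θ _ y hy =>
      (h _ (circleMap_zero_mem_sphere hρ θ) y hy.1).const_smul _

theorem ContinuousLinearMap.circleIntegral_comp_comm [CompleteSpace V] [CompleteSpace E]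
    (L : V →L[ℂ] E) {ρ : ℝ}
    {f : ℂ → V} (hf : CircleIntegrable f 0 ρ) :
    (∮ z in C(0, ρ), L (f z)) = L (∮ z in C(0, ρ), f z) := by
  simp only [circleIntegral, ← map_smul]
  exact L.intervalIntegral_comp_comm hf.out

/-- The functional `A ↦ ∮ A f` on operator-valued holomorphic functions `A` on `|z| < ε` is
bounded by `b` with respect to the supremum norm over `|z| = ρ`. -/
def TestBound (ε ρ : ℝ) (f : ℂ → V) (b : ℝ) : Prop :=
  ∀ (A : ℂ → V →L[ℂ] V) (a : ℝ), DifferentiableOn ℂ A (ball 0 ε) →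
    (∀ z ∈ sphere (0 : ℂ) ρ, ‖A z‖ ≤ a) → ‖∮ z in C(0, ρ), A z (f z)‖ ≤ b * a

theorem TestBound.norm_pole_sub_le [CompleteSpace V] {ε ρ a b : ℝ} (hρ : 0 < ρ) (hρε : ρ < ε)
    {f : ℂ → V} (hf : ContinuousOn f (sphere 0 ρ)) (h : TestBound ε ρ f b)
    {A : ℂ → V →L[ℂ] V} (hA : DifferentiableOn ℂ A (ball 0 ε))
    (ha : ∀ z ∈ sphere (0 : ℂ) ρ, ‖A z‖ ≤ a) :
    ‖(∮ z in C(0, ρ), z⁻¹ • A z (f z)) - A 0 (∮ z in C(0, ρ), z⁻¹ • f z)‖ ≤ b * (2 * a / ρ) := by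
  have hε : (0 : ℂ) ∈ ball (0 : ℂ) ε := mem_ball_self (hρ.trans hρε)
  have hsub : closedBall (0 : ℂ) ρ ⊆ ball 0 ε := closedBall_subset_ball hρε
  have hA0 : ‖A 0‖ ≤ a := by
    refine Complex.norm_le_of_forall_mem_frontier_norm_le (U := ball 0 ρ) isBounded_ball
      ((hA.mono (closure_ball_subset_closedBall.trans hsub)).diffContOnCl) ?_
      (subset_closure (mem_ball_self hρ))
    rwa [frontier_ball _ hρ.ne']
  have hne : ∀ z ∈ sphere (0 : ℂ) ρ, z ≠ 0 := fun z hz => ne_of_mem_sphere hz hρ.ne'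
  have hinv : ContinuousOn (fun z : ℂ => z⁻¹) (sphere 0 ρ) := continuousOn_id.inv₀ hne
  have hAc : ContinuousOn A (sphere 0 ρ) :=
    hA.continuousOn.mono (sphere_subset_closedBall.trans hsub)
  have hi : CircleIntegrable (fun z => z⁻¹ • f z) 0 ρ := (hinv.smul hf).circleIntegrable hρ.le
  have hi' : CircleIntegrable (fun z => A 0 (z⁻¹ • f z)) 0 ρ :=
    ((A 0).continuous.comp_continuousOn (hinv.smul hf)).circleIntegrable hρ.le
  have hi'' : CircleIntegrable (fun z => z⁻¹ • A z (f z)) 0 ρ :=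
    (hinv.smul (hAc.clm_apply hf)).circleIntegrable hρ.le
  have hslope : ∀ z ∈ sphere (0 : ℂ) ρ, dslope A 0 z = z⁻¹ • (A z - A 0) := fun z hz => by
    simp [dslope_of_ne A (hne z hz), slope_def_module]
  rw [← (A 0).circleIntegral_comp_comm hi, ← circleIntegral.integral_sub hi'' hi',
    circleIntegral.integral_congr (g := fun z => dslope A 0 z (f z)) hρ.le]
  · refine h _ _ ((Complex.differentiableOn_dslope (isOpen_ball.mem_nhds hε)).2 hA) fun z hz => ?_
    rw [hslope z hz, norm_smul, norm_inv, mem_sphere_zero_iff_norm.1 hz, inv_mul_eq_div]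
    gcongr
    linarith [norm_sub_le (A z) (A 0), ha z hz]
  · intro z hz
    simp [hslope z hz, smul_sub]

end Analysis

section FlatFamily

variable {T Y V : Type*} [NormedAddCommGroup T] [NormedSpace ℂ T]
  [NormedAddCommGroup Y] [NormedSpace ℂ Y] [NormedAddCommGroup V] [NormedSpace ℂ V]

/-- A family `S z p`, `0 < |z| < ε`, `p ∈ O`, of solutions of the linear system
`∂S/∂p = z⁻¹ G S`, `z ∂S/∂z = z⁻¹ U S - c S`. -/
structure IsFlatFamily (ε : ℝ) (O : Set (T × Y)) (c : ℂ)
    (G : ℂ → T × Y → T × Y →L[ℂ] V →L[ℂ] V) (U : ℂ → T × Y → V →L[ℂ] V)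
    (S : ℂ → T × Y → V) : Prop where
  isOpen : IsOpen O
  continuousOn_G : ContinuousOn (Function.uncurry G) (ball 0 ε ×ˢ O)
  differentiableOn_G : ∀ p ∈ O, DifferentiableOn ℂ (fun z => G z p) (ball 0 ε)
  continuousOn_U : ContinuousOn (Function.uncurry U) (ball 0 ε ×ˢ O)
  differentiableOn_U : ∀ p ∈ O, DifferentiableOn ℂ (fun z => U z p) (ball 0 ε)
  continuousOn_S : ContinuousOn (Function.uncurry S) ((ball 0 ε \ {0}) ×ˢ O)
  hasFDerivAt : ∀ z ∈ ball (0 : ℂ) ε \ {0}, ∀ p ∈ O,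
    HasFDerivAt (S z) (z⁻¹ • (G z p).flip (S z p)) p
  hasDerivAt : ∀ z ∈ ball (0 : ℂ) ε \ {0}, ∀ p ∈ O,
    HasDerivAt (fun z => S z p) (z⁻¹ • (z⁻¹ • U z p (S z p) - c • S z p)) z

variable {ε ρ : ℝ} {O : Set (T × Y)} {c : ℂ} {G : ℂ → T × Y → T × Y →L[ℂ] V →L[ℂ] V}
  {U : ℂ → T × Y → V →L[ℂ] V} {S : ℂ → T × Y → V}

theorem sphere_subset_ball_diff (hρ : 0 < ρ) (hρε : ρ < ε) :
    sphere (0 : ℂ) ρ ⊆ ball 0 ε \ {0} := fun _ hz =>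
  ⟨closedBall_subset_ball hρε (sphere_subset_closedBall hz), ne_of_mem_sphere hz hρ.ne'⟩

namespace IsFlatFamily

theorem mono (H : IsFlatFamily ε O c G U S) {ε' : ℝ} (h : ε' ≤ ε) {O' : Set (T × Y)}
    (hO' : IsOpen O') (hO : O' ⊆ O) : IsFlatFamily ε' O' c G U S where
  isOpen := hO'
  continuousOn_G := H.continuousOn_G.mono (prod_mono (ball_subset_ball h) hO)
  differentiableOn_G p hp := (H.differentiableOn_G p (hO hp)).mono (ball_subset_ball h)
  continuousOn_U := H.continuousOn_U.mono (prod_mono (ball_subset_ball h) hO)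
  differentiableOn_U p hp := (H.differentiableOn_U p (hO hp)).mono (ball_subset_ball h)
  continuousOn_S :=
    H.continuousOn_S.mono (prod_mono (sdiff_subset_sdiff_left (ball_subset_ball h)) hO)
  hasFDerivAt z hz p hp := H.hasFDerivAt z ⟨ball_subset_ball h hz.1, hz.2⟩ p (hO hp)
  hasDerivAt z hz p hp := H.hasDerivAt z ⟨ball_subset_ball h hz.1, hz.2⟩ p (hO hp)

theorem continuousOn_sphere (H : IsFlatFamily ε O c G U S) (hρ : 0 < ρ) (hρε : ρ < ε) {p : T × Y}
    (hp : p ∈ O) : ContinuousOn (fun z => S z p) (sphere 0 ρ) :=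
  (H.continuousOn_S.uncurry_right p hp).mono (sphere_subset_ball_diff hρ hρε)

theorem continuousOn_derivative (H : IsFlatFamily ε O c G U S) :
    ContinuousOn (fun q : ℂ × T × Y => q.1⁻¹ • (G q.1 q.2).flip (S q.1 q.2))
      ((ball 0 ε \ {0}) ×ˢ O) := by
  have hG : ContinuousOn (fun q : ℂ × T × Y => (G q.1 q.2).flip) ((ball 0 ε \ {0}) ×ˢ O) :=
    (ContinuousLinearMap.flipₗᵢ ℂ (T × Y) V V).continuous.comp_continuousOn
      (H.continuousOn_G.mono (prod_mono_left sdiff_subset))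
  have hinv : ContinuousOn (fun q : ℂ × T × Y => q.1⁻¹) ((ball 0 ε \ {0}) ×ˢ O) :=
    continuousOn_fst.inv₀ fun q hq => hq.1.2
  exact hinv.smul (hG.clm_apply H.continuousOn_S)

theorem exists_hasFDerivAt_circleIntegral [ProperSpace T] [ProperSpace Y] [CompleteSpace V]
    (H : IsFlatFamily ε O c G U S)
    (hρ : 0 < ρ) (hρε : ρ < ε) {A : ℂ → V →L[ℂ] V} (hA : DifferentiableOn ℂ A (ball 0 ε))
    {p : T × Y} (hp : p ∈ O) :
    ∃ L : T × Y →L[ℂ] V, HasFDerivAt (fun p => ∮ z in C(0, ρ), A z (S z p)) L p ∧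
      ∀ v, L v = ∮ z in C(0, ρ), z⁻¹ • ((A z).comp (G z p v)) (S z p) := by
  have hs := sphere_subset_ball_diff hρ hρε
  have hsub : sphere (0 : ℂ) ρ ×ˢ O ⊆ (ball 0 ε \ {0}) ×ˢ O := prod_mono_left hs
  have hAc : ContinuousOn (fun q : ℂ × T × Y => A q.1) (sphere 0 ρ ×ˢ O) :=
    hA.continuousOn.comp continuousOn_fst fun q hq => (hs hq.1).1
  have hd : ContinuousOn (Function.uncurry fun z p => (A z).comp (z⁻¹ • (G z p).flip (S z p)))
      (sphere 0 ρ ×ˢ O) :=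
    hAc.clm_comp (H.continuousOn_derivative.mono hsub)
  refine ⟨_, hasFDerivAt_circleIntegral H.isOpen hρ.le (f := fun z p => A z (S z p))
    (f' := fun z p => (A z).comp (z⁻¹ • (G z p).flip (S z p)))
    (hAc.clm_apply (H.continuousOn_S.mono hsub)) hd
    (fun z hz p hp => (A z).hasFDerivAt.comp p (H.hasFDerivAt z (hs hz) p hp)) hp, fun v => ?_⟩
  have := (ContinuousLinearMap.apply ℂ V v).circleIntegral_comp_comm
    ((hd.uncurry_right p hp).circleIntegrable hρ.le)
  simpa using this.symm

theorem integral_inv_smul_U (H : IsFlatFamily ε O c G U S) [CompleteSpace V]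
    (hρ : 0 < ρ) (hρε : ρ < ε) {p : T × Y} (hp : p ∈ O) :
    (∮ z in C(0, ρ), z⁻¹ • U z p (S z p)) = (c - 1) • ∮ z in C(0, ρ), S z p := by
  have hs := sphere_subset_ball_diff hρ hρε
  have hS := H.continuousOn_sphere hρ hρε hp
  have hU : ContinuousOn (fun z => z⁻¹ • U z p (S z p)) (sphere 0 ρ) :=
    (continuousOn_id.inv₀ fun z hz => (hs hz).2).smul
      (((H.continuousOn_U.uncurry_right p hp).mono fun z hz => (hs hz).1).clm_apply hS)
  have hS' : ContinuousOn (fun z => (c - 1) • S z p) (sphere 0 ρ) := hS.const_smul (c - 1)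
  have key := circleIntegral.integral_eq_zero_of_hasDerivWithinAt (c := 0) hρ.le
    (f := fun z => z • S z p) (f' := fun z => z⁻¹ • U z p (S z p) - (c - 1) • S z p)
    fun z hz => by
      have hz0 : z ≠ 0 := (hs hz).2
      refine HasDerivAt.hasDerivWithinAt ?_
      refine ((hasDerivAt_id' z).fun_smul (H.hasDerivAt z (hs hz) p hp)).congr_deriv ?_
      rw [smul_inv_smul₀ hz0]
      module
  rwa [circleIntegral.integral_sub (hU.circleIntegrable hρ.le)
    (hS'.circleIntegrable hρ.le), circleIntegral.integral_smul,
    sub_eq_zero] at key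

/-- The `y`-derivatives of all the functionals `∮ A S` at `p` are controlled by the functionals
themselves, as soon as the action of `∂/∂y` on the residue is controlled by the actions of
`∂/∂t` and `z ∂/∂z`. -/
theorem norm_integral_inv_smul_le [ProperSpace T] [ProperSpace Y] [CompleteSpace V]
    (H : IsFlatFamily ε O c G U S) (hρ : 0 < ρ) (hρε : ρ < ε) {p : T × Y} {r : ℝ} (hr : 0 < r)
    (hp : ball p r ⊆ O) {b g K : ℝ} (hb : 0 ≤ b)
    (hbp : ∀ τ : T, ‖τ‖ < r → TestBound ε ρ (fun z => S z (p + (τ, 0))) b)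
    (hG : ∀ z ∈ sphere (0 : ℂ) ρ, ‖G z p‖ ≤ g) (hU : ∀ z ∈ sphere (0 : ℂ) ρ, ‖U z p‖ ≤ g)
    (hK : ∀ (v : V) (b : ℝ), (∀ τ, ‖G 0 p (τ, 0) v‖ ≤ b * ‖τ‖) → ‖U 0 p v‖ ≤ b →
      ∀ y, ‖G 0 p (0, y) v‖ ≤ K * b * ‖y‖)
    {A : ℂ → V →L[ℂ] V} {a : ℝ} (hA : DifferentiableOn ℂ A (ball 0 ε))
    (ha : ∀ z ∈ sphere (0 : ℂ) ρ, ‖A z‖ ≤ a) (y : Y) :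
    ‖∮ z in C(0, ρ), z⁻¹ • ((A z).comp (G z p (0, y))) (S z p)‖ ≤
      (K * (2 / r + 2 * g / ρ + ‖c - 1‖) + 2 * g / ρ) * b * a * ‖y‖ := by
  have hpO : p ∈ O := hp (mem_ball_self hr)
  have hS := H.continuousOn_sphere hρ hρε hpO
  have hρmem : ((ρ : ℝ) : ℂ) ∈ sphere (0 : ℂ) ρ := by simp [abs_of_pos hρ]
  have hg0 : 0 ≤ g := (norm_nonneg (G ρ p)).trans (hG _ hρmem)
  have ha0 : 0 ≤ a := (norm_nonneg (A ρ)).trans (ha _ hρmem)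
  have hB : TestBound ε ρ (fun z => S z p) b := by
    simpa only [Prod.mk_zero_zero, add_zero] using hbp 0 (by simpa using hr)
  have hL1 : ∀ q, (∀ B, TestBound ε ρ (fun z => S z q) B → ‖∮ z in C(0, ρ), S z q‖ ≤ B) := by
    intro q B hq
    simpa using hq (fun _ => ContinuousLinearMap.id ℂ V) 1 (differentiableOn_const _)
      fun _ _ => ContinuousLinearMap.norm_id_le
  have hGd : ∀ v, DifferentiableOn ℂ (fun z => G z p v) (ball 0 ε) := fun v =>
    (H.differentiableOn_G p hpO).clm_apply (differentiableOn_const v)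
  have hGv : ∀ v, ∀ z ∈ sphere (0 : ℂ) ρ, ‖G z p v‖ ≤ g * ‖v‖ := fun v z hz =>
    (G z p).le_of_opNorm_le (hG z hz) v
  have hτ : ∀ τ, ‖G 0 p (τ, 0) (∮ z in C(0, ρ), z⁻¹ • S z p)‖ ≤
      (b * (2 / r + 2 * g / ρ + ‖c - 1‖)) * ‖τ‖ := by
    intro τ
    rcases eq_or_ne τ 0 with rfl | hτ0
    · have : ((0 : T), (0 : Y)) = 0 := rfl
      simp [this]
    have hτp : 0 < ‖τ‖ := norm_pos_iff.2 hτ0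
    have hnear := hB.norm_pole_sub_le hρ hρε hS (hGd (τ, 0)) (a := g * ‖τ‖)
      (by simpa using hGv (τ, 0))
    have hderiv : ∀ s : ℂ, ‖s‖ < r / ‖τ‖ → p + s • ((τ, 0) : T × Y) ∈ O := by
      intro s hs
      refine hp ?_
      rw [mem_ball, dist_eq_norm, add_sub_cancel_left, norm_smul]
      rw [lt_div_iff₀ hτp] at hs
      simpa using hs
    obtain ⟨L, hL, hLv⟩ := H.exists_hasFDerivAt_circleIntegral hρ hρε
      (differentiableOn_const (ContinuousLinearMap.id ℂ V)) hpO
    have hφ : HasDerivAt (fun s : ℂ => ∮ z in C(0, ρ), S z (p + s • ((τ, 0) : T × Y)))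
        (L (τ, 0)) 0 := by
      have h1 : HasDerivAt (fun s : ℂ => p + s • ((τ, 0) : T × Y)) (τ, 0) 0 := by
        simpa using ((hasDerivAt_id (0 : ℂ)).smul_const ((τ, 0) : T × Y)).const_add p
      have h2 : HasFDerivAt (fun p => ∮ z in C(0, ρ), S z p) L
          (p + (0 : ℂ) • ((τ, 0) : T × Y)) := by simpa using hL
      exact h2.comp_hasDerivAt 0 h1
    have hcauchy : ‖L (τ, 0)‖ ≤ b / (r / ‖τ‖ / 2) := by
      rw [← hφ.deriv]
      have hR : r / ‖τ‖ / 2 < r / ‖τ‖ := half_lt_self (div_pos hr hτp)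
      refine Complex.norm_deriv_le_of_forall_mem_sphere_norm_le (half_pos (div_pos hr hτp))
        (DifferentiableOn.diffContOnCl ?_) fun s hs => hL1 _ _ ?_
      · intro s hs
        have hs' : ‖s‖ < r / ‖τ‖ := by
          have := closure_ball_subset_closedBall hs
          rw [mem_closedBall_zero_iff] at this
          linarith
        obtain ⟨L', hL', -⟩ := H.exists_hasFDerivAt_circleIntegral hρ hρε
          (differentiableOn_const (ContinuousLinearMap.id ℂ V)) (hderiv s hs')
        have h3 : DifferentiableAt ℂ (fun s : ℂ => p + s • ((τ, 0) : T × Y)) s := by fun_prop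
        exact (hL'.differentiableAt.comp s h3).differentiableWithinAt
      · have hs' : ‖s • τ‖ < r := by
          rw [norm_smul, ← lt_div_iff₀ hτp, mem_sphere_zero_iff_norm.1 hs]
          exact hR
        simpa using hbp _ hs'
    simp only [ContinuousLinearMap.id_comp] at hLv
    rw [← hLv] at hnear
    have := norm_le_insert (L (τ, 0)) (G 0 p (τ, 0) (∮ z in C(0, ρ), z⁻¹ • S z p))
    calc _ ≤ _ := this
      _ ≤ b / (r / ‖τ‖ / 2) + b * (2 * (g * ‖τ‖) / ρ) := add_le_add hcauchy hnear
      _ = b * (2 / r + 2 * g / ρ) * ‖τ‖ := by field_simp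
      _ ≤ _ := by
        refine mul_le_mul_of_nonneg_right (mul_le_mul_of_nonneg_left ?_ hb) (norm_nonneg τ)
        linarith [norm_nonneg (c - 1)]
  have hUσ : ‖U 0 p (∮ z in C(0, ρ), z⁻¹ • S z p)‖ ≤
      b * (2 / r + 2 * g / ρ + ‖c - 1‖) := by
    have hnear := hB.norm_pole_sub_le hρ hρε hS (H.differentiableOn_U p hpO) hU
    have hint : ‖∮ z in C(0, ρ), z⁻¹ • U z p (S z p)‖ ≤ ‖c - 1‖ * b := by
      rw [H.integral_inv_smul_U hρ hρε hpO, norm_smul]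
      gcongr
      exact hL1 _ _ hB
    have := norm_le_insert (∮ z in C(0, ρ), z⁻¹ • U z p (S z p))
      (U 0 p (∮ z in C(0, ρ), z⁻¹ • S z p))
    have h2r : 0 ≤ b * (2 / r) := by positivity
    calc _ ≤ _ := this
      _ ≤ ‖c - 1‖ * b + b * (2 * g / ρ) := add_le_add hint hnear
      _ ≤ _ := by linarith
  have hy := hK _ _ hτ hUσ y
  have hnear := hB.norm_pole_sub_le hρ hρε hS (A := fun z => (A z).comp (G z p (0, y)))
    (a := a * (g * ‖y‖)) (hA.clm_comp (hGd (0, y))) fun z hz =>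
      (ContinuousLinearMap.opNorm_comp_le _ _).trans
        (mul_le_mul (ha z hz) (by simpa using hGv (0, y) z hz) (norm_nonneg _) ha0)
  have hA0 : ‖A 0‖ ≤ a := by
    refine Complex.norm_le_of_forall_mem_frontier_norm_le (U := ball 0 ρ) isBounded_ball
      ((hA.mono (closure_ball_subset_closedBall.trans
        (closedBall_subset_ball hρε))).diffContOnCl) ?_ (subset_closure (mem_ball_self hρ))
    rwa [frontier_ball _ hρ.ne']
  have hfirst : ‖((A 0).comp (G 0 p (0, y))) (∮ z in C(0, ρ), z⁻¹ • S z p)‖ ≤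
      a * (K * (b * (2 / r + 2 * g / ρ + ‖c - 1‖)) * ‖y‖) :=
    ((A 0).le_of_opNorm_le hA0 _).trans (mul_le_mul_of_nonneg_left hy ha0)
  have := norm_le_insert' (∮ z in C(0, ρ), z⁻¹ • ((A z).comp (G z p (0, y))) (S z p))
    (((A 0).comp (G 0 p (0, y))) (∮ z in C(0, ρ), z⁻¹ • S z p))
  calc _ ≤ _ := this
    _ ≤ a * (K * (b * (2 / r + 2 * g / ρ + ‖c - 1‖)) * ‖y‖) + b * (2 * (a * (g * ‖y‖)) / ρ) :=
      add_le_add hfirst hnear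
    _ = _ := by ring

theorem exists_testBound [ProperSpace T] [ProperSpace Y] [CompleteSpace V]
    (H : IsFlatFamily ε O c G U S) (hρ : 0 < ρ) (hρε : ρ < ε) {K : ℝ} (hK0 : 0 ≤ K)
    (hK : ∀ p ∈ O, ∀ (v : V) (b : ℝ), (∀ τ, ‖G 0 p (τ, 0) v‖ ≤ b * ‖τ‖) → ‖U 0 p v‖ ≤ b →
      ∀ y, ‖G 0 p (0, y) v‖ ≤ K * b * ‖y‖)
    (h0 : ∀ t : T, (t, (0 : Y)) ∈ O → ∀ A : ℂ → V →L[ℂ] V, DifferentiableOn ℂ A (ball 0 ε) →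
      ∮ z in C(0, ρ), A z (S z (t, 0)) = 0)
    (k : ℕ) : ∀ t : T, (t, (0 : Y)) ∈ O → ∃ M, 0 ≤ M ∧ ∀ᶠ p in 𝓝 (t, (0 : Y)),
      TestBound ε ρ (fun z => S z p) (M * ‖p.2‖ ^ k) := by
  have hs := sphere_subset_ball_diff hρ hρε
  induction k with
  | zero =>
    intro t ht
    obtain ⟨M, hM0, hM⟩ := exists_eventually_forall_norm_le_of_continuousOn
      (isCompact_sphere 0 ρ) H.isOpen (H.continuousOn_S.mono (prod_mono_left hs)) ht
    refine ⟨2 * Real.pi * ρ * M, by positivity, ?_⟩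
    filter_upwards [hM] with p hp A a _ ha
    calc _ ≤ 2 * Real.pi * ρ * (a * M) :=
          circleIntegral.norm_integral_le_of_norm_le_const hρ.le fun z hz =>
            (A z).le_of_opNorm_le_of_le (ha z hz) (hp z hz)
      _ = _ := by ring
  | succ k ih =>
    intro t ht
    obtain ⟨M, hM0, hM⟩ := ih t ht
    have hsb : sphere (0 : ℂ) ρ ⊆ ball 0 ε := hs.trans sdiff_subset
    obtain ⟨g₁, hg₁0, hg₁⟩ := exists_eventually_forall_norm_le_of_continuousOn
      (E := T × Y →L[ℂ] V →L[ℂ] V) (f := G) (isCompact_sphere 0 ρ) H.isOpen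
      (H.continuousOn_G.mono (prod_mono_left hsb)) ht
    obtain ⟨g₂, hg₂0, hg₂⟩ := exists_eventually_forall_norm_le_of_continuousOn
      (E := V →L[ℂ] V) (f := U) (isCompact_sphere 0 ρ) H.isOpen
      (H.continuousOn_U.mono (prod_mono_left hsb)) ht
    obtain ⟨r, hr, hball⟩ := Metric.eventually_nhds_iff_ball.1
      (hM.and ((H.isOpen.eventually_mem ht).and (hg₁.and hg₂)))
    have hr2 : 0 < r / 2 := half_pos hr
    set g := max g₁ g₂ with hg
    set B := K * (2 / (r / 2) + 2 * g / ρ + ‖c - 1‖) + 2 * g / ρ with hB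
    have hg0 : 0 ≤ g := hg₁0.trans (le_max_left _ _)
    have hB0 : 0 ≤ B := by positivity
    refine ⟨B * M, mul_nonneg hB0 hM0, ?_⟩
    filter_upwards [ball_mem_nhds (t, (0 : Y)) hr2] with p hp A a hA ha
    have ha0 : 0 ≤ a := (norm_nonneg (A ρ)).trans (ha _ (by simp [abs_of_pos hρ]))
    have hq : ∀ s ∈ Icc (0 : ℝ) 1, (p.1, (s : ℂ) • p.2) ∈ ball (t, (0 : Y)) (r / 2) := by
      intro s hs
      rw [mem_ball, Prod.dist_eq, max_lt_iff] at hp ⊢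
      refine ⟨hp.1, lt_of_le_of_lt ?_ hp.2⟩
      simp only [dist_zero_right, norm_smul, Complex.norm_real, Real.norm_eq_abs,
        abs_of_nonneg hs.1]
      exact mul_le_of_le_one_left (norm_nonneg _) hs.2
    have hsub : ∀ q ∈ ball (t, (0 : Y)) (r / 2), ball q (r / 2) ⊆ ball (t, (0 : Y)) r := by
      intro q hq
      refine ball_subset_ball' ?_
      linarith [mem_ball.1 hq]
    have hpt : (p.1, (0 : Y)) ∈ O := by
      have := hq 0 (by simp)
      simp only [Complex.ofReal_zero, zero_smul] at this
      exact (hball _ (ball_subset_ball (half_le_self hr.le) this)).2.1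
    have hderiv : ∀ s ∈ Icc (0 : ℝ) 1, HasDerivWithinAt
        (fun s : ℝ => ∮ z in C(0, ρ), A z (S z (p.1, (s : ℂ) • p.2)))
        (∮ z in C(0, ρ), z⁻¹ • ((A z).comp (G z (p.1, (s : ℂ) • p.2) (0, p.2)))
          (S z (p.1, (s : ℂ) • p.2))) (Icc 0 1) s := by
      intro s hs
      obtain ⟨L, hL, hLv⟩ := H.exists_hasFDerivAt_circleIntegral hρ hρε hA
        (hball _ (ball_subset_ball (half_le_self hr.le) (hq s hs))).2.1
      rw [← hLv]
      have h1 : HasDerivAt (fun s : ℂ => (p.1, s • p.2)) ((0 : T), p.2) (s : ℂ) := by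
        simpa using (hasDerivAt_const (s : ℂ) p.1).prodMk ((hasDerivAt_id (s : ℂ)).smul_const p.2)
      have h2 := (hL.comp_hasDerivAt (s : ℂ) h1).scomp s Complex.ofRealCLM.hasDerivAt
      rw [Complex.ofRealCLM_apply, Complex.ofReal_one, one_smul] at h2
      exact h2.hasDerivWithinAt
    have hbound : ∀ s ∈ Ico (0 : ℝ) 1,
        ‖∮ z in C(0, ρ), z⁻¹ • ((A z).comp (G z (p.1, (s : ℂ) • p.2) (0, p.2)))
          (S z (p.1, (s : ℂ) • p.2))‖ ≤ B * M * ‖p.2‖ ^ (k + 1) * a := by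
      intro s hs
      have hqs := hq s (Ico_subset_Icc_self hs)
      have hqr := hball _ (ball_subset_ball (half_le_self hr.le) hqs)
      have hle : ‖(s : ℂ) • p.2‖ ≤ ‖p.2‖ := by
        simp only [norm_smul, Complex.norm_real, Real.norm_eq_abs, abs_of_nonneg hs.1]
        exact mul_le_of_le_one_left (norm_nonneg _) hs.2.le
      calc _ ≤ B * (M * ‖(s : ℂ) • p.2‖ ^ k) * a * ‖p.2‖ :=
            H.norm_integral_inv_smul_le hρ hρε hr2
              (fun q hq' => (hball q (hsub _ hqs hq')).2.1) (by positivity) (fun τ hτ => by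
                have := (hball ((p.1, (s : ℂ) • p.2) + (τ, 0))
                  (hsub _ hqs (by simpa using hτ))).1
                simpa only [Prod.snd_add, add_zero] using this)
              (fun z hz => (hqr.2.2.1 z hz).trans (le_max_left _ _))
              (fun z hz => (hqr.2.2.2 z hz).trans (le_max_right _ _))
              (hK _ hqr.2.1) hA ha p.2
        _ ≤ B * (M * ‖p.2‖ ^ k) * a * ‖p.2‖ := by gcongr
        _ = _ := by ring
    have := norm_image_sub_le_of_norm_deriv_le_segment_01' hderiv hbound
    simpa [h0 p.1 hpt A hA] using this

theorem circleIntegral_eq_zero [ProperSpace T] [ProperSpace Y] [CompleteSpace V] {δ : ℝ}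
    (H : IsFlatFamily ε (ball 0 δ) c G U S) (hρ : 0 < ρ) (hρε : ρ < ε) {K : ℝ} (hK0 : 0 ≤ K)
    (hK : ∀ p ∈ ball 0 δ, ∀ (v : V) (b : ℝ), (∀ τ, ‖G 0 p (τ, 0) v‖ ≤ b * ‖τ‖) →
      ‖U 0 p v‖ ≤ b → ∀ y, ‖G 0 p (0, y) v‖ ≤ K * b * ‖y‖)
    (h0 : ∀ t : T, (t, (0 : Y)) ∈ ball 0 δ → ∃ f : ℂ → V, DifferentiableOn ℂ f (ball 0 ε) ∧
      ∀ z ∈ ball (0 : ℂ) ε, z ≠ 0 → f z = S z (t, 0))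
    {A : ℂ → V →L[ℂ] V} (hA : DifferentiableOn ℂ A (ball 0 ε)) {p : T × Y} (hp : p ∈ ball 0 δ) :
    ∮ z in C(0, ρ), A z (S z p) = 0 := by
  have hs := sphere_subset_ball_diff hρ hρε
  have h0' : ∀ t : T, (t, (0 : Y)) ∈ ball 0 δ → ∀ A : ℂ → V →L[ℂ] V,
      DifferentiableOn ℂ A (ball 0 ε) → ∮ z in C(0, ρ), A z (S z (t, 0)) = 0 := by
    intro t ht A hA
    obtain ⟨f, hf, hfS⟩ := h0 t ht
    rw [circleIntegral.integral_congr (g := fun z => A z (f z)) hρ.le fun z hz => by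
      simp only [hfS z (hs hz).1 (hs hz).2]]
    exact (((hA.clm_apply hf).mono (closure_ball_subset_closedBall.trans
      (closedBall_subset_ball hρε))).diffContOnCl).circleIntegral_eq_zero hρ.le
  obtain ⟨t, y⟩ := p
  rw [mem_ball_zero_iff, Prod.norm_def, max_lt_iff] at hp
  have hδ : 0 < δ := (norm_nonneg t).trans_lt hp.1
  have ht : (t, (0 : Y)) ∈ ball (0 : T × Y) δ := by
    rw [mem_ball_zero_iff, Prod.norm_def, max_lt_iff]
    exact ⟨hp.1, by simpa using hδ⟩
  rcases eq_or_ne y 0 with rfl | hy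
  · exact h0' t ht A hA
  have hy0 : 0 < ‖y‖ := norm_pos_iff.2 hy
  obtain ⟨a, ha⟩ := (isCompact_sphere (0 : ℂ) ρ).exists_bound_of_continuousOn
    (hA.continuousOn.mono fun z hz => (hs hz).1)
  have hline : ∀ s ∈ ball (0 : ℂ) (δ / ‖y‖), (t, s • y) ∈ ball (0 : T × Y) δ := by
    intro s hs
    rw [mem_ball_zero_iff, lt_div_iff₀ hy0, ← norm_smul] at hs
    rw [mem_ball_zero_iff, Prod.norm_def, max_lt_iff]
    exact ⟨hp.1, hs⟩
  set φ : ℂ → V := fun s => ∮ z in C(0, ρ), A z (S z (t, s • y)) with hφ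
  have hφd : DifferentiableOn ℂ φ (ball 0 (δ / ‖y‖)) := by
    intro s hs
    obtain ⟨L, hL, -⟩ := H.exists_hasFDerivAt_circleIntegral hρ hρε hA (hline s hs)
    have h1 : DifferentiableAt ℂ (fun s : ℂ => (t, s • y)) s := by fun_prop
    exact (hL.differentiableAt.comp s h1).differentiableWithinAt
  have hmem : (0 : ℂ) ∈ ball (0 : ℂ) (δ / ‖y‖) := mem_ball_self (div_pos hδ hy0)
  have hφa := hφd.analyticOnNhd isOpen_ball
  have hev : ∀ᶠ s in 𝓝 0, φ s = 0 := by
    by_contra hne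
    obtain ⟨k, g, hg, hg0, hφg⟩ := (hφa 0 hmem).exists_eventuallyEq_pow_smul_nonzero_iff.2 hne
    obtain ⟨M, hM0, hM⟩ := H.exists_testBound hρ hρε hK0 hK h0' (k + 1) t ht
    have hcont : Tendsto (fun s : ℂ => (t, s • y)) (𝓝 0) (𝓝 (t, 0)) := by
      have : Continuous fun s : ℂ => (t, s • y) := by fun_prop
      simpa using this.tendsto 0
    have hle : ∀ᶠ s in 𝓝[≠] (0 : ℂ), ‖g s‖ ≤ M * ‖y‖ ^ (k + 1) * a * ‖s‖ := by
      filter_upwards [(hcont.eventually hM).filter_mono nhdsWithin_le_nhds,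
        hφg.filter_mono nhdsWithin_le_nhds, self_mem_nhdsWithin] with s hsM hsg hs0
      have h1 : ‖φ s‖ ≤ M * ‖s • y‖ ^ (k + 1) * a := hsM A a hA ha
      rw [hsg, sub_zero, norm_smul, norm_pow, norm_smul] at h1
      have hpos : 0 < ‖s‖ ^ k := pow_pos (norm_pos_iff.2 hs0) k
      refine le_of_mul_le_mul_left (h1.trans_eq ?_) hpos
      ring
    have hlim : Tendsto (fun s : ℂ => M * ‖y‖ ^ (k + 1) * a * ‖s‖) (𝓝[≠] 0) (𝓝 0) := by
      have : Continuous fun s : ℂ => M * ‖y‖ ^ (k + 1) * a * ‖s‖ := by fun_prop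
      simpa using (this.tendsto 0).mono_left nhdsWithin_le_nhds
    have := le_of_tendsto_of_tendsto
      (hg.continuousAt.norm.tendsto.mono_left nhdsWithin_le_nhds) hlim hle
    exact hg0 (norm_le_zero_iff.1 this)
  have h1 : (1 : ℂ) ∈ ball (0 : ℂ) (δ / ‖y‖) := by
    rw [mem_ball_zero_iff, norm_one, lt_div_iff₀ hy0, one_mul]
    exact hp.2
  have := hφa.eqOn_zero_of_preconnected_of_eventuallyEq_zero
    (convex_ball _ _).isPreconnected hmem hev h1
  simpa [hφ] using this

end IsFlatFamily

/-- Cauchy's formula on a punctured disc, for a function without principal part. -/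
theorem circleIntegral_sub_inv_smul_of_punctured [CompleteSpace V] {f : ℂ → V}
    (hf : DifferentiableOn ℂ f (ball 0 ε \ {0})) (hρε : ρ < ε) {z : ℂ} (hz0 : z ≠ 0)
    (hz : z ∈ ball (0 : ℂ) ρ) (h : ∮ ζ in C(0, ‖z‖ / 2), (ζ - z)⁻¹ • f ζ = 0) :
    ∮ ζ in C(0, ρ), (ζ - z)⁻¹ • f ζ = (2 * Real.pi * Complex.I : ℂ) • f z := by
  rw [mem_ball_zero_iff] at hz
  have hzp : 0 < ‖z‖ := norm_pos_iff.2 hz0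
  have hO : IsOpen (ball (0 : ℂ) ε \ {0}) := isOpen_ball.sdiff isClosed_singleton
  have hd := (Complex.differentiableOn_dslope (c := z)
    (hO.mem_nhds ⟨by simpa using hz.trans hρε, hz0⟩)).2 hf
  have hann : closedBall (0 : ℂ) ρ \ ball 0 (‖z‖ / 2) ⊆ ball 0 ε \ {0} := fun ζ hζ =>
    ⟨closedBall_subset_ball hρε hζ.1, fun h0 => hζ.2 (by
      rw [mem_singleton_iff.1 h0]; exact mem_ball_self (half_pos hzp))⟩
  have key := Complex.circleIntegral_eq_of_differentiable_on_annulus_off_countable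
    (half_pos hzp) (by linarith : ‖z‖ / 2 ≤ ρ) countable_empty (hd.continuousOn.mono hann)
    fun ζ hζ => hd.differentiableAt (hO.mem_nhds
      (hann ⟨ball_subset_closedBall hζ.1.1, fun h' => hζ.1.2 (ball_subset_closedBall h')⟩))
  have split : ∀ r, 0 < r → r < ε → r ≠ ‖z‖ → (∮ ζ in C(0, r), dslope f z ζ) =
      (∮ ζ in C(0, r), (ζ - z)⁻¹ • f ζ) - (∮ ζ in C(0, r), (ζ - z)⁻¹) • f z := by
    intro r hr hrε hrz
    have hne : ∀ ζ ∈ sphere (0 : ℂ) r, ζ ≠ z := by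
      rintro ζ hζ rfl
      exact hrz (mem_sphere_zero_iff_norm.1 hζ).symm
    have hinv : ContinuousOn (fun ζ : ℂ => (ζ - z)⁻¹) (sphere 0 r) :=
      (continuousOn_id.sub continuousOn_const).inv₀ fun ζ hζ => sub_ne_zero.2 (hne ζ hζ)
    have hfc := hf.continuousOn.mono (sphere_subset_ball_diff hr hrε)
    have h1 : ContinuousOn (fun ζ => (ζ - z)⁻¹ • f ζ) (sphere 0 r) := hinv.smul hfc
    have h2 : ContinuousOn (fun ζ => (ζ - z)⁻¹ • f z) (sphere 0 r) :=
      hinv.smul continuousOn_const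
    rw [← circleIntegral.integral_smul_const, ← circleIntegral.integral_sub
      (h1.circleIntegrable hr.le) (h2.circleIntegrable hr.le)]
    refine circleIntegral.integral_congr hr.le fun ζ hζ => ?_
    simp only [dslope_of_ne f (hne ζ hζ), slope_def_module, smul_sub]
  have hzero : ∮ ζ in C(0, ‖z‖ / 2), (ζ - z)⁻¹ = 0 := by
    refine (DifferentiableOn.diffContOnCl ?_).circleIntegral_eq_zero (half_pos hzp).le
    intro ζ hζ
    have hζz : ζ - z ≠ 0 := by
      rw [sub_ne_zero]
      rintro rfl
      have := mem_closedBall_zero_iff.1 (closure_ball_subset_closedBall hζ)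
      linarith
    have : DifferentiableAt ℂ (fun ζ : ℂ => (ζ - z)⁻¹) ζ := by fun_prop (disch := assumption)
    exact this.differentiableWithinAt
  rw [split ρ (hzp.trans hz) hρε hz.ne', split _ (half_pos hzp) (by linarith) (by linarith), h,
    hzero, circleIntegral.integral_sub_inv_of_mem_ball (by simpa using hz)] at key
  simpa [sub_eq_zero] using key

theorem differentiableOn_circleIntegral_sub_inv_smul {X : Type*} [NormedAddCommGroup X]
    [NormedSpace ℂ X] [ProperSpace X] {O : Set X} (hO : IsOpen O) (hρ : 0 < ρ) {f : ℂ → X → V}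
    {f' : ℂ → X → X →L[ℂ] V} (hf : ContinuousOn (Function.uncurry f) (sphere 0 ρ ×ˢ O))
    (hf' : ContinuousOn (Function.uncurry f') (sphere 0 ρ ×ˢ O))
    (h : ∀ z ∈ sphere (0 : ℂ) ρ, ∀ x ∈ O, HasFDerivAt (f z) (f' z x) x) :
    DifferentiableOn ℂ (fun q : ℂ × X => ∮ ζ in C(0, ρ), (ζ - q.1)⁻¹ • f ζ q.2)
      (ball 0 ρ ×ˢ O) := by
  have hne : ∀ ζ ∈ sphere (0 : ℂ) ρ, ∀ q ∈ ball (0 : ℂ) ρ ×ˢ O, ζ - q.1 ≠ 0 := by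
    intro ζ hζ q hq h
    rw [sub_eq_zero] at h
    have h1 := mem_ball_zero_iff.1 hq.1
    rw [← h, mem_sphere_zero_iff_norm.1 hζ] at h1
    exact lt_irrefl _ h1
  set W := sphere (0 : ℂ) ρ ×ˢ (ball (0 : ℂ) ρ ×ˢ O) with hW
  have hinv : ContinuousOn (fun x : ℂ × ℂ × X => (x.1 - x.2.1)⁻¹) W :=
    (by fun_prop : Continuous fun x : ℂ × ℂ × X => x.1 - x.2.1).continuousOn.inv₀
      fun x hx => hne _ hx.1 _ hx.2
  have hproj : ContinuousOn (fun x : ℂ × ℂ × X => (x.1, x.2.2)) W := by fun_prop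
  have hmaps : MapsTo (fun x : ℂ × ℂ × X => (x.1, x.2.2)) W (sphere 0 ρ ×ˢ O) :=
    fun x hx => ⟨hx.1, hx.2.2⟩
  have hS : ContinuousOn (fun x : ℂ × ℂ × X => f x.1 x.2.2) W := hf.comp hproj hmaps
  have hD : ContinuousOn (fun x : ℂ × ℂ × X => f' x.1 x.2.2) W := hf'.comp hproj hmaps
  let L : V →L[ℂ] (ℂ × X →L[ℂ] V) :=
    ContinuousLinearMap.smulRightL ℂ (ℂ × X) V (ContinuousLinearMap.fst ℂ ℂ X)
  have hL : ContinuousOn (fun x : ℂ × ℂ × X => L (f x.1 x.2.2)) W :=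
    L.continuous.comp_continuousOn hS
  have hD' : ContinuousOn (fun x : ℂ × ℂ × X =>
      (f' x.1 x.2.2).comp (ContinuousLinearMap.snd ℂ ℂ X)) W :=
    hD.clm_comp continuousOn_const
  have hd1 : ContinuousOn (fun x : ℂ × ℂ × X => (x.1 - x.2.1)⁻¹ •
      (f' x.1 x.2.2).comp (ContinuousLinearMap.snd ℂ ℂ X)) W := hinv.smul hD'
  have hd2 : ContinuousOn (fun x : ℂ × ℂ × X => ((x.1 - x.2.1)⁻¹ * (x.1 - x.2.1)⁻¹) •
      L (f x.1 x.2.2)) W := (hinv.mul hinv).smul hL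
  have hd : ContinuousOn (Function.uncurry fun (ζ : ℂ) (q : ℂ × X) =>
      (ζ - q.1)⁻¹ • (f' ζ q.2).comp (ContinuousLinearMap.snd ℂ ℂ X) +
        ((ζ - q.1)⁻¹ * (ζ - q.1)⁻¹) • L (f ζ q.2)) W := hd1.add hd2
  intro q hq
  have hint := hasFDerivAt_circleIntegral (isOpen_ball.prod hO) hρ.le
    (f := fun (ζ : ℂ) (q : ℂ × X) => (ζ - q.1)⁻¹ • f ζ q.2) (hinv.smul hS) hd
    (fun ζ hζ q hq => ?_) hq
  · exact hint.differentiableAt.differentiableWithinAt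
  have h1 : HasFDerivAt (fun q : ℂ × X => ζ - q.1) (-ContinuousLinearMap.fst ℂ ℂ X) q :=
    hasFDerivAt_fst.const_sub ζ
  have h2 : HasFDerivAt (fun q : ℂ × X => (ζ - q.1)⁻¹) _ q :=
    (hasDerivAt_inv (hne ζ hζ q hq)).comp_hasFDerivAt q h1
  have h3 : HasFDerivAt (fun q : ℂ × X => f ζ q.2) _ q :=
    (h ζ hζ q.2 hq.2).comp q hasFDerivAt_snd
  refine (h2.smul h3).congr_fderiv (ContinuousLinearMap.ext fun v => ?_)
  have hLv : ∀ x, L x v = v.1 • x := fun _ => rfl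
  simp [hLv, pow_two, mul_smul]

/-- Propagation of regularity at `z = 0` from `y = 0` to a neighbourhood. -/
theorem IsFlatFamily.exists_differentiableOn_extension [ProperSpace T] [ProperSpace Y]
    [CompleteSpace V] {δ : ℝ} (H : IsFlatFamily ε (ball 0 δ) c G U S) (hρ : 0 < ρ) (hρε : ρ < ε)
    {K : ℝ} (hK0 : 0 ≤ K)
    (hK : ∀ p ∈ ball 0 δ, ∀ (v : V) (b : ℝ), (∀ τ, ‖G 0 p (τ, 0) v‖ ≤ b * ‖τ‖) →
      ‖U 0 p v‖ ≤ b → ∀ y, ‖G 0 p (0, y) v‖ ≤ K * b * ‖y‖)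
    (h0 : ∀ t : T, (t, (0 : Y)) ∈ ball 0 δ → ∃ f : ℂ → V, DifferentiableOn ℂ f (ball 0 ε) ∧
      ∀ z ∈ ball (0 : ℂ) ε, z ≠ 0 → f z = S z (t, 0)) :
    ∃ R : ℂ × T × Y → V, DifferentiableOn ℂ R (ball 0 ρ ×ˢ ball 0 δ) ∧
      ∀ z ∈ ball (0 : ℂ) ρ, ∀ p ∈ ball (0 : T × Y) δ, z ≠ 0 → R (z, p) = S z p := by
  have hs := sphere_subset_ball_diff hρ hρε
  refine ⟨fun q => (2 * Real.pi * Complex.I : ℂ)⁻¹ • ∮ ζ in C(0, ρ), (ζ - q.1)⁻¹ • S ζ q.2,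
    ?_, ?_⟩
  · intro q hq
    exact ((differentiableOn_circleIntegral_sub_inv_smul isOpen_ball hρ
      (f' := fun z p => z⁻¹ • (G z p).flip (S z p))
      (H.continuousOn_S.mono (prod_mono_left hs)) (H.continuousOn_derivative.mono
      (prod_mono_left hs)) fun ζ hζ => H.hasFDerivAt ζ (hs hζ)) q hq).const_smul _
  · intro z hz p hp hz0
    have hzp : 0 < ‖z‖ := norm_pos_iff.2 hz0
    have hzε : ‖z‖ ≤ ε := (mem_ball_zero_iff.1 hz).le.trans hρε.le
    have hA : DifferentiableOn ℂ (fun ζ : ℂ => (ζ - z)⁻¹ • ContinuousLinearMap.id ℂ V)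
        (ball 0 ‖z‖) := by
      refine DifferentiableOn.smul_const (DifferentiableOn.inv (by fun_prop) fun ζ hζ h => ?_) _
      rw [sub_eq_zero] at h
      simp [h] at hζ
    have := (H.mono hzε isOpen_ball le_rfl).circleIntegral_eq_zero (half_pos hzp)
      (half_lt_self hzp) hK0 hK (fun t ht => by
        obtain ⟨f, hf, hfS⟩ := h0 t ht
        exact ⟨f, hf.mono (ball_subset_ball hzε), fun ζ hζ => hfS ζ (ball_subset_ball hzε hζ)⟩)
      hA hp
    simp only
    rw [circleIntegral_sub_inv_smul_of_punctured (f := fun ζ => S ζ p) (fun ζ hζ =>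
      (H.hasDerivAt ζ hζ p hp).differentiableAt.differentiableWithinAt) hρε hz0 hz
      (by simpa using this), inv_smul_smul₀ Complex.two_pi_I_ne_zero]

end FlatFamily

section Coordinates

variable {m l : ℕ} {W : Type*} [NormedAddCommGroup W] [NormedSpace ℂ W]

/-- The linear map on `ℂ^m × ℂ^l` with prescribed values on the standard basis vectors. -/
def ofCoordinates (a : Fin m → W) (b : Fin l → W) : (Fin m → ℂ) × (Fin l → ℂ) →L[ℂ] W :=
  ∑ i, ((ContinuousLinearMap.proj (R := ℂ) (φ := fun _ => ℂ) i).comp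
      (ContinuousLinearMap.fst ℂ (Fin m → ℂ) (Fin l → ℂ))).smulRight (a i) +
    ∑ α, ((ContinuousLinearMap.proj (R := ℂ) (φ := fun _ => ℂ) α).comp
      (ContinuousLinearMap.snd ℂ (Fin m → ℂ) (Fin l → ℂ))).smulRight (b α)

theorem ofCoordinates_apply (a : Fin m → W) (b : Fin l → W) (v : (Fin m → ℂ) × (Fin l → ℂ)) :
    ofCoordinates a b v = ∑ i, v.1 i • a i + ∑ α, v.2 α • b α := by
  simp [ofCoordinates]

theorem ofCoordinates_single (a : Fin m → W) (b : Fin l → W) (i : Fin m) :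
    ofCoordinates a b (Pi.single i 1, 0) = a i := by
  simp [ofCoordinates_apply, Pi.single_apply, ite_smul]

theorem eq_ofCoordinates (f : (Fin m → ℂ) × (Fin l → ℂ) →L[ℂ] W) :
    f = ofCoordinates (fun i => f (Pi.single i 1, 0)) (fun α => f (0, Pi.single α 1)) := by
  refine ContinuousLinearMap.ext fun v => ?_
  have h1 : f (v.1, 0) = ∑ i, v.1 i • f (Pi.single i 1, 0) := by
    have := map_sum (f.comp (ContinuousLinearMap.inl ℂ (Fin m → ℂ) (Fin l → ℂ)))
      (fun i => v.1 i • (Pi.single i 1 : Fin m → ℂ)) Finset.univ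
    rw [← pi_eq_sum_univ' v.1] at this
    simp only [map_smul] at this
    exact this
  have h2 : f (0, v.2) = ∑ α, v.2 α • f (0, Pi.single α 1) := by
    have := map_sum (f.comp (ContinuousLinearMap.inr ℂ (Fin m → ℂ) (Fin l → ℂ)))
      (fun i => v.2 i • (Pi.single i 1 : Fin l → ℂ)) Finset.univ
    rw [← pi_eq_sum_univ' v.2] at this
    simp only [map_smul] at this
    exact this
  rw [ofCoordinates_apply, ← h1, ← h2, ← map_add]
  simp

theorem DifferentiableOn.ofCoordinates {E : Type*} [NormedAddCommGroup E] [NormedSpace ℂ E]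
    {a : Fin m → E → W} {b : Fin l → E → W} {s : Set E} (ha : ∀ i, DifferentiableOn ℂ (a i) s)
    (hb : ∀ α, DifferentiableOn ℂ (b α) s) :
    DifferentiableOn ℂ (fun q => ofCoordinates (fun i => a i q) fun α => b α q) s := by
  have key : ∀ (L : (Fin m → ℂ) × (Fin l → ℂ) →L[ℂ] ℂ) {g : E → W}, DifferentiableOn ℂ g s →
      DifferentiableOn ℂ (fun q => L.smulRight (g q)) s := fun L g hg =>
    (ContinuousLinearMap.smulRightL ℂ ((Fin m → ℂ) × (Fin l → ℂ)) W
      L).differentiable.comp_differentiableOn hg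
  exact (DifferentiableOn.fun_sum fun i _ => key _ (ha i)).add
    (DifferentiableOn.fun_sum fun α _ => key _ (hb α))

end Coordinates

section Gram

variable {m l : ℕ} {V : Type*} [NormedRing V] [NormedAlgebra ℂ V] (T : V →L[ℂ] V)

/-- The operator `X ↦ T(A) X - X B`. -/
def sylvester : V × V →L[ℂ] V →L[ℂ] V :=
  (ContinuousLinearMap.mul ℂ V).comp (T.comp (ContinuousLinearMap.fst ℂ V V)) -
    (ContinuousLinearMap.mul ℂ V).flip.comp (ContinuousLinearMap.snd ℂ V V)

theorem sylvester_apply (A B X : V) : sylvester T (A, B) X = T A * X - X * B := rfl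

/-- The action of `∂/∂t` and `∂/∂y` on Gram matrices, up to the factor `z⁻¹`. -/
def gramConnection (C : Fin m → PtZ m l → V) (F : Fin l → PtZ m l → V) (z : ℂ)
    (p : (Fin m → ℂ) × (Fin l → ℂ)) : (Fin m → ℂ) × (Fin l → ℂ) →L[ℂ] V →L[ℂ] V :=
  ofCoordinates (fun i => sylvester T (C i (z, p), C i (-z, p)))
    fun α => sylvester T (F α (z, p), F α (-z, p))

variable {T} {ε : ℝ} {N : Set ((Fin m → ℂ) × (Fin l → ℂ))} {C : Fin m → PtZ m l → V}
  {F : Fin l → PtZ m l → V} {U R : PtZ m l → V}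

theorem DifferentiableOn.sylvester {A : PtZ m l → V}
    (hA : DifferentiableOn ℂ A (ball 0 ε ×ˢ N)) :
    DifferentiableOn ℂ (fun q : PtZ m l => sylvester T (A q, A (-q.1, q.2)))
      (ball 0 ε ×ˢ N) := by
  have hneg : DifferentiableOn ℂ (fun q : PtZ m l => (-q.1, q.2)) (ball 0 ε ×ˢ N) := by fun_prop
  exact (_root_.sylvester T).differentiable.comp_differentiableOn
    (hA.prodMk (hA.comp hneg fun q hq => ⟨by simpa using hq.1, hq.2⟩))

theorem DifferentiableOn.comp_prodMk_right {X W : Type*} [NormedAddCommGroup X] [NormedSpace ℂ X]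
    [NormedAddCommGroup W] [NormedSpace ℂ W] {f : ℂ → X → W} {s : Set ℂ} {O : Set X}
    (hf : DifferentiableOn ℂ (Function.uncurry f) (s ×ˢ O)) {p : X} (hp : p ∈ O) :
    DifferentiableOn ℂ (fun z => f z p) s :=
  hf.comp (differentiableOn_id.prodMk (differentiableOn_const p)) fun _ hz => ⟨hz, hp⟩

theorem isFlatFamily_gram (hN : IsOpen N) (hC : ∀ i, DifferentiableOn ℂ (C i) (ball 0 ε ×ˢ N))
    (hF : ∀ α, DifferentiableOn ℂ (F α) (ball 0 ε ×ˢ N))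
    (hU : DifferentiableOn ℂ U (ball 0 ε ×ˢ N))
    (hR : DifferentiableOn ℂ R ((ball (0 : ℂ) ε \ {0}) ×ˢ N))
    (hRz : ∀ z ∈ ball (0 : ℂ) ε, z ≠ 0 → ∀ p ∈ N, z • fderiv ℂ R (z, p) (1, 0) =
      z⁻¹ • (T (U (z, p)) * R (z, p) - R (z, p) * U (-z, p)))
    (hRt : ∀ z ∈ ball (0 : ℂ) ε, z ≠ 0 → ∀ p ∈ N, ∀ i, fderiv ℂ R (z, p) (0, Pi.single i 1, 0) =
      z⁻¹ • (T (C i (z, p)) * R (z, p) - R (z, p) * C i (-z, p)))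
    (hRy : ∀ z ∈ ball (0 : ℂ) ε, z ≠ 0 → ∀ p ∈ N, ∀ α, fderiv ℂ R (z, p) (0, 0, Pi.single α 1) =
      z⁻¹ • (T (F α (z, p)) * R (z, p) - R (z, p) * F α (-z, p))) (w : ℤ) :
    IsFlatFamily ε N (w : ℂ) (gramConnection T C F)
      (fun z p => sylvester T (U (z, p), U (-z, p))) fun z p => z ^ (-w) • R (z, p) := by
  have hG : DifferentiableOn ℂ (Function.uncurry (gramConnection T C F)) (ball 0 ε ×ˢ N) :=
    DifferentiableOn.ofCoordinates (fun i => (hC i).sylvester) fun α => (hF α).sylvester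
  have hRd : ∀ z ∈ ball (0 : ℂ) ε \ {0}, ∀ p ∈ N, DifferentiableAt ℂ R (z, p) :=
    fun z hz p hp => hR.differentiableAt
      (((isOpen_ball.sdiff isClosed_singleton).prod hN).mem_nhds ⟨hz, hp⟩)
  refine ⟨hN, hG.continuousOn, fun p hp =>
      DifferentiableOn.comp_prodMk_right (f := gramConnection T C F) hG hp, hU.sylvester.continuousOn,
    fun p hp => DifferentiableOn.comp_prodMk_right
      (f := fun z p => sylvester T (U (z, p), U (-z, p))) hU.sylvester hp,
    ?_, fun z hz p hp => ?_, fun z hz p hp => ?_⟩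
  · exact (continuousOn_fst.zpow₀ _ fun q hq => Or.inl hq.1.2).smul hR.continuousOn
  · set D := (fderiv ℂ R (z, p)).comp (ContinuousLinearMap.inr ℂ ℂ ((Fin m → ℂ) × (Fin l → ℂ)))
    have h1 : HasFDerivAt (fun p => R (z, p)) D p :=
      (hRd z hz p hp).hasFDerivAt.comp p (hasFDerivAt_prodMk_right z p)
    refine (h1.const_smul (z ^ (-w))).congr_fderiv (ContinuousLinearMap.ext fun v => ?_)
    have hDt : ∀ i, D (Pi.single i 1, 0) = z⁻¹ • sylvester T (C i (z, p), C i (-z, p)) (R (z, p)) :=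
      fun i => hRt z hz.1 hz.2 p hp i
    have hDy : ∀ α, D (0, Pi.single α 1) = z⁻¹ • sylvester T (F α (z, p), F α (-z, p)) (R (z, p)) :=
      fun α => hRy z hz.1 hz.2 p hp α
    have hDv : D v = z⁻¹ • gramConnection T C F z p v (R (z, p)) := by
      rw [eq_ofCoordinates D, gramConnection, ofCoordinates_apply, ofCoordinates_apply]
      simp only [hDt, hDy, add_apply, sum_apply,
        smul_apply, smul_add, Finset.smul_sum, smul_comm z⁻¹]
    simp only [smul_apply, ContinuousLinearMap.flip_apply, map_smul, hDv,
      smul_comm z⁻¹]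
  · have hz0 : z ≠ 0 := hz.2
    have h1 : HasDerivAt (fun z => R (z, p)) (fderiv ℂ R (z, p) (1, 0)) z :=
      (hRd z hz p hp).hasFDerivAt.comp_hasDerivAt z
        ((hasDerivAt_id z).prodMk (hasDerivAt_const z p))
    have h2 : fderiv ℂ R (z, p) (1, 0) =
        z⁻¹ • z⁻¹ • sylvester T (U (z, p), U (-z, p)) (R (z, p)) := by
      rw [eq_inv_smul_iff₀ hz0]
      exact hRz z hz.1 hz0 p hp
    refine ((hasDerivAt_zpow (-w) z (Or.inl hz0)).smul h1).congr_deriv ?_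
    rw [h2, zpow_sub_one₀ hz0, map_smul]
    push_cast
    module

theorem norm_gramConnection_le {δ K : ℝ}
    (hK : ∀ p ∈ ball 0 δ, ∀ (X : V) (b : ℝ),
      (∀ i, ‖T (C i (0, p)) * X - X * C i (0, p)‖ ≤ b) →
      ‖T (U (0, p)) * X - X * U (0, p)‖ ≤ b → ∀ α, ‖T (F α (0, p)) * X - X * F α (0, p)‖ ≤ K * b)
    {p : (Fin m → ℂ) × (Fin l → ℂ)} (hp : p ∈ ball 0 δ) {X : V} {b : ℝ}
    (hC : ∀ τ, ‖gramConnection T C F 0 p (τ, 0) X‖ ≤ b * ‖τ‖)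
    (hU : ‖sylvester T (U (0, p), U (-0, p)) X‖ ≤ b) (y : Fin l → ℂ) :
    ‖gramConnection T C F 0 p (0, y) X‖ ≤ l * K * b * ‖y‖ := by
  have hb : 0 ≤ b := (norm_nonneg _).trans hU
  have hCX : ∀ i, ‖T (C i (0, p)) * X - X * C i (0, p)‖ ≤ b := fun i => by
    simpa [gramConnection, ofCoordinates_single, sylvester_apply, Pi.norm_single] using hC (Pi.single i 1)
  have hUX : ‖T (U (0, p)) * X - X * U (0, p)‖ ≤ b := by simpa [sylvester_apply] using hU
  have hexp : gramConnection T C F 0 p (0, y) X =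
      ∑ α, y α • (T (F α (0, p)) * X - X * F α (0, p)) := by
    simp [gramConnection, ofCoordinates_apply, sylvester_apply]
  have hle : ∀ α ∈ Finset.univ, ‖y α • (T (F α (0, p)) * X - X * F α (0, p))‖ ≤ ‖y‖ * (K * b) :=
    fun α _ => by
      rw [norm_smul]
      exact mul_le_mul (norm_le_pi_norm y α) (hK p hp X b hCX hUX α) (norm_nonneg _)
        (norm_nonneg _)
  rw [hexp]
  calc _ ≤ ∑ _α : Fin l, ‖y‖ * (K * b) := norm_sum_le_of_le _ hle
    _ = _ := by simp; ring

theorem exists_gram_extension [CompleteSpace V] {T : V → V} (hT : IsBoundedLinearMap ℂ T)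
    {δ K : ℝ} {w : ℤ} (hε : 0 < ε) (hK0 : 0 ≤ K)
    (hC : ∀ i, DifferentiableOn ℂ (C i) (ball 0 ε ×ˢ ball 0 δ))
    (hF : ∀ α, DifferentiableOn ℂ (F α) (ball 0 ε ×ˢ ball 0 δ))
    (hU : DifferentiableOn ℂ U (ball 0 ε ×ˢ ball 0 δ))
    (hK : ∀ p ∈ ball 0 δ, ∀ (X : V) (b : ℝ),
      (∀ i, ‖T (C i (0, p)) * X - X * C i (0, p)‖ ≤ b) →
      ‖T (U (0, p)) * X - X * U (0, p)‖ ≤ b → ∀ α, ‖T (F α (0, p)) * X - X * F α (0, p)‖ ≤ K * b)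
    (hR : DifferentiableOn ℂ R ((ball (0 : ℂ) ε \ {0}) ×ˢ ball 0 δ))
    (hRz : ∀ z ∈ ball (0 : ℂ) ε, z ≠ 0 → ∀ p ∈ ball 0 δ, z • fderiv ℂ R (z, p) (1, 0) =
      z⁻¹ • (T (U (z, p)) * R (z, p) - R (z, p) * U (-z, p)))
    (hRt : ∀ z ∈ ball (0 : ℂ) ε, z ≠ 0 → ∀ p ∈ ball 0 δ, ∀ i,
      fderiv ℂ R (z, p) (0, Pi.single i 1, 0) =
        z⁻¹ • (T (C i (z, p)) * R (z, p) - R (z, p) * C i (-z, p)))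
    (hRy : ∀ z ∈ ball (0 : ℂ) ε, z ≠ 0 → ∀ p ∈ ball 0 δ, ∀ α,
      fderiv ℂ R (z, p) (0, 0, Pi.single α 1) =
        z⁻¹ • (T (F α (z, p)) * R (z, p) - R (z, p) * F α (-z, p)))
    (hext : ∀ t, (t, 0) ∈ ball (0 : (Fin m → ℂ) × (Fin l → ℂ)) δ →
      ∃ g : ℂ → V, DifferentiableOn ℂ g (ball 0 ε) ∧
        ∀ z ∈ ball (0 : ℂ) ε, z ≠ 0 → g z = z ^ (-w) • R (z, t, 0)) :
    ∃ Rhat : PtZ m l → V, DifferentiableOn ℂ Rhat (ball 0 (ε / 2) ×ˢ ball 0 δ) ∧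
      ∀ z ∈ ball (0 : ℂ) (ε / 2), ∀ p ∈ ball 0 δ, z ≠ 0 → Rhat (z, p) = z ^ (-w) • R (z, p) :=
  (isFlatFamily_gram (T := hT.toContinuousLinearMap) isOpen_ball hC hF hU hR hRz hRt hRy
    w).exists_differentiableOn_extension (half_pos hε) (half_lt_self hε) (K := l * K)
    (by positivity)
    (fun p hp X b hCX hUX => norm_gramConnection_le (T := hT.toContinuousLinearMap) hK hp hCX hUX)
    hext

end Gram

section Generation

attribute [local instance] Matrix.linftyOpNormedRing Matrix.linftyOpNormedAlgebra

theorem transpose_mul_sub_mul_mul {n : ℕ} {A B : Mat n} (h : Commute A B) (X : Mat n) :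
    (A * B).transpose * X - X * (A * B) =
      B.transpose * (A.transpose * X - X * A) + (B.transpose * X - X * B) * A := by
  have hX : X * (A * B) = X * B * A := by rw [h.eq, mul_assoc]
  rw [hX, Matrix.transpose_mul]
  noncomm_ring

variable {P : Type*} [TopologicalSpace P] {p₀ : P} {n r : ℕ} {B : Fin r → P → Mat n}

theorem continuousAt_list_prod_map (hB : ∀ i, ContinuousAt (B i) p₀) (L : List (Fin r)) :
    ContinuousAt (fun p => (L.map fun i => B i p).prod) p₀ := by
  induction L with
  | nil => simpa using continuousAt_const
  | cons i L ih => simpa using (hB i).fun_mul ih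

theorem eventually_norm_le_of_continuousAt {E : Type*} [SeminormedAddCommGroup E] {f : P → E}
    (hf : ContinuousAt f p₀) : ∃ M, 0 ≤ M ∧ ∀ᶠ p in 𝓝 p₀, ‖f p‖ ≤ M :=
  ⟨‖f p₀‖ + 1, by positivity, (hf.norm.eventually (gt_mem_nhds (lt_add_one _))).mono
    fun _ => le_of_lt⟩

theorem exists_eventually_norm_word_le (hB : ∀ i, ContinuousAt (B i) p₀)
    (hcomm : ∀ᶠ p in 𝓝 p₀, ∀ i j, Commute (B i p) (B j p)) (L : List (Fin r)) :
    ∃ K, 0 ≤ K ∧ ∀ᶠ p in 𝓝 p₀, ∀ (X : Mat n) (b : ℝ),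
      (∀ i, ‖(B i p).transpose * X - X * B i p‖ ≤ b) →
      ‖(L.map fun i => B i p).prod.transpose * X - X * (L.map fun i => B i p).prod‖ ≤ K * b := by
  induction L with
  | nil => exact ⟨0, le_rfl, .of_forall fun p X b _ => by simp⟩
  | cons i L ih =>
    obtain ⟨K, hK0, hK⟩ := ih
    obtain ⟨M₁, hM₁0, hM₁⟩ := eventually_norm_le_of_continuousAt (hB i)
    obtain ⟨M₂, hM₂0, hM₂⟩ := eventually_norm_le_of_continuousAt
      (continuous_id.matrix_transpose.continuousAt.comp (continuousAt_list_prod_map hB L))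
    refine ⟨M₂ + K * M₁, by positivity, ?_⟩
    filter_upwards [hK, hM₁, hM₂, hcomm] with p hK hM₁ hM₂ hcomm X b hb
    have hb0 : 0 ≤ b := (norm_nonneg _).trans (hb i)
    have hc : Commute (B i p) (L.map fun i => B i p).prod :=
      Commute.list_prod_right _ _ fun x hx => by
        obtain ⟨j, -, rfl⟩ := List.mem_map.1 hx
        exact hcomm i j
    rw [List.map_cons, List.prod_cons, transpose_mul_sub_mul_mul hc]
    calc _ ≤ M₂ * b + (K * b) * M₁ := norm_add_le_of_le
          (norm_mul_le_of_le hM₂ (hb i)) (norm_mul_le_of_le (hK X b hb) hM₁)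
      _ = _ := by ring

theorem GenCond.exists_linearIndependent {B : Fin r → Mat n} {ζ : Fin n → ℂ} (h : GenCond B ζ) :
    ∃ L : Fin n → List (Fin r),
      LinearIndependent ℂ fun j => Matrix.mulVec ((L j).map B).prod ζ := by
  obtain ⟨f, hf, -, hli⟩ := Submodule.exists_fun_fin_finrank_span_eq ℂ
    {v : Fin n → ℂ | ∃ L : List (Fin r), v = Matrix.mulVec (L.map B).prod ζ}
  have hn : Module.finrank ℂ (Submodule.span ℂ
      {v : Fin n → ℂ | ∃ L : List (Fin r), v = Matrix.mulVec (L.map B).prod ζ}) = n := by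
    rw [GenCond] at h
    rw [h, finrank_top, Module.finrank_fin_fun]
  choose L hL using hf
  refine ⟨L ∘ finCongr hn.symm, ?_⟩
  have hfL : (fun j => Matrix.mulVec (((L ∘ finCongr hn.symm) j).map B).prod ζ) =
      f ∘ finCongr hn.symm := funext fun j => (hL _).symm
  rw [hfL]
  exact hli.comp (finCongr hn.symm) (finCongr hn.symm).injective

/-- Under the generation condition, a matrix commuting with the `B i` is a polynomial in them
with locally bounded coefficients. -/
theorem exists_eventually_norm_le_of_genCond {ζ : Fin n → ℂ} {F : P → Mat n}
    (hB : ∀ i, ContinuousAt (B i) p₀) (hF : ContinuousAt F p₀)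
    (hcomm : ∀ᶠ p in 𝓝 p₀, ∀ i j, Commute (B i p) (B j p))
    (hcommF : ∀ᶠ p in 𝓝 p₀, ∀ i, Commute (F p) (B i p))
    (hgen : GenCond (fun i => B i p₀) ζ) :
    ∃ K, 0 ≤ K ∧ ∀ᶠ p in 𝓝 p₀, ∀ (X : Mat n) (b : ℝ),
      (∀ i, ‖(B i p).transpose * X - X * B i p‖ ≤ b) →
      ‖(F p).transpose * X - X * F p‖ ≤ K * b := by
  obtain ⟨L, hL⟩ := hgen.exists_linearIndependent
  let W : Fin n → P → Mat n := fun j p => ((L j).map fun i => B i p).prod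
  have hW : ∀ j, ContinuousAt (W j) p₀ := fun j => continuousAt_list_prod_map hB (L j)
  let Q : P → Mat n := fun p => Matrix.of fun k j => (W j p).mulVec ζ k
  have hmulVec : Continuous fun A : Mat n => A.mulVec ζ :=
    continuous_id.matrix_mulVec continuous_const
  have hQ : ContinuousAt Q p₀ := continuousAt_pi.2 fun k => continuousAt_pi.2 fun j =>
    ((continuous_apply k).comp hmulVec).continuousAt.comp (hW j)
  have hdet : ContinuousAt (fun p => (Q p).det) p₀ :=
    continuous_id.matrix_det.continuousAt.comp hQ
  have hdet0 : (Q p₀).det ≠ 0 := by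
    rw [← isUnit_iff_ne_zero, ← Matrix.isUnit_iff_isUnit_det,
      ← Matrix.linearIndependent_cols_iff_isUnit]
    exact hL
  let a : P → Fin n → ℂ := fun p =>
    (Q p).det⁻¹ • (Q p).adjugate.mulVec ((F p).mulVec ζ)
  have hadj : ContinuousAt (fun p => (Q p).adjugate) p₀ :=
    continuous_id.matrix_adjugate.continuousAt.comp hQ
  have hFζ : ContinuousAt (fun p => (F p).mulVec ζ) p₀ := hmulVec.continuousAt.comp hF
  have hmul : Continuous fun x : Mat n × (Fin n → ℂ) => x.1.mulVec x.2 :=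
    continuous_fst.matrix_mulVec continuous_snd
  have hadjF : ContinuousAt (fun p => (Q p).adjugate.mulVec ((F p).mulVec ζ)) p₀ :=
    hmul.continuousAt.comp (f := fun p => ((Q p).adjugate, (F p).mulVec ζ)) (hadj.prodMk hFζ)
  have ha : ContinuousAt a p₀ := (hdet.inv₀ hdet0).smul hadjF
  have hFW : ∀ᶠ p in 𝓝 p₀, F p = ∑ j, a p j • W j p := by
    filter_upwards [hdet.eventually_ne hdet0, hcomm, hcommF] with p hp hcomm hcommF
    have hQa : (Q p).mulVec (a p) = (F p).mulVec ζ := by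
      rw [Matrix.mulVec_smul, Matrix.mulVec_mulVec, Matrix.mul_adjugate,
        Matrix.smul_mulVec, Matrix.one_mulVec, inv_smul_smul₀ hp]
    have hWc : ∀ j (A : Mat n), (∀ i, Commute A (B i p)) → Commute A (W j p) := fun j A hA =>
      Commute.list_prod_right _ _ fun x hx => by
        obtain ⟨i, -, rfl⟩ := List.mem_map.1 hx
        exact hA i
    set Z := F p - ∑ j, a p j • W j p with hZ
    have hZW : ∀ k, Commute Z (W k p) := fun k =>
      (hWc k _ hcommF).sub_left (Commute.sum_left _ _ _ fun j _ =>
        ((hWc k _ fun i => (hWc j _ fun i' => hcomm i i').symm).smul_left _))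
    have hZζ : Z.mulVec ζ = 0 := by
      rw [hZ, Matrix.sub_mulVec, ← hQa, sub_eq_zero]
      rw [Matrix.mulVec_eq_sum, Matrix.sum_mulVec]
      exact Finset.sum_congr rfl fun j _ => by
        rw [Matrix.smul_mulVec, op_smul_eq_smul]
        rfl
    have hZQ : Z * Q p = 0 := by
      ext k j
      have : (Z * Q p) k j = Z.mulVec ((W j p).mulVec ζ) k := rfl
      rw [this, Matrix.mulVec_mulVec, (hZW j).eq, ← Matrix.mulVec_mulVec, hZζ,
        Matrix.mulVec_zero]
      rfl
    have hQu : IsUnit (Q p) := (Matrix.isUnit_iff_isUnit_det _).2 (isUnit_iff_ne_zero.2 hp)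
    exact sub_eq_zero.1 (hQu.mul_left_eq_zero.1 hZQ)
  choose K hK0 hK using fun j => exists_eventually_norm_word_le hB hcomm (L j)
  obtain ⟨M, hM0, hM⟩ := eventually_norm_le_of_continuousAt ha
  refine ⟨∑ j, M * K j, Finset.sum_nonneg fun j _ => mul_nonneg hM0 (hK0 j), ?_⟩
  filter_upwards [hFW, hM, eventually_all.2 hK] with p hFW hM hK X b hb
  have : (F p).transpose * X - X * F p =
      ∑ j, a p j • ((W j p).transpose * X - X * W j p) := by
    rw [hFW]
    simp only [Matrix.transpose_sum, Matrix.transpose_smul, Finset.sum_mul, Finset.mul_sum,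
      smul_sub, Finset.sum_sub_distrib, Matrix.smul_mul, Matrix.mul_smul]
  rw [this, Finset.sum_mul]
  refine norm_sum_le_of_le _ fun j _ => ?_
  rw [norm_smul, mul_assoc]
  exact mul_le_mul ((norm_le_pi_norm _ _).trans hM) (hK j X b hb) (norm_nonneg _) hM0

section Entrywise

variable {E : Type*} [NormedAddCommGroup E] [NormedSpace ℂ E] {n : ℕ} {f : E → Mat n}

theorem mDiffOn_iff_differentiableOn {s : Set E} : MDiffOn f s ↔ DifferentiableOn ℂ f s := by
  constructor
  · intro h
    have : f = fun q => ∑ k, ∑ j, f q k j • (Matrix.single k j 1 : Mat n) := by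
      ext1 q
      simpa using Matrix.matrix_eq_sum_single (f q)
    rw [this]
    exact DifferentiableOn.fun_sum fun k _ => DifferentiableOn.fun_sum fun j _ =>
      (h k j).smul_const _
  · intro h k j
    exact ((⟨Matrix.entryLinearMap ℂ ℂ k j, continuous_id.matrix_elem k j⟩ :
      Mat n →L[ℂ] ℂ).differentiable.comp_differentiableOn h)

theorem mpderiv_eq_fderiv {p : E} (h : DifferentiableAt ℂ f p) (v : E) :
    mpderiv f p v = fderiv ℂ f p v := by
  ext k j
  have := ((⟨Matrix.entryLinearMap ℂ ℂ k j, continuous_id.matrix_elem k j⟩ :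
      Mat n →L[ℂ] ℂ).hasFDerivAt.comp p h.hasFDerivAt).fderiv
  exact congrArg (fun L => L v) this

end Entrywise

section Extension

variable {m l n : ℕ} {ε : ℝ} {N : Set ((Fin m → ℂ) × (Fin l → ℂ))} {C : Fin m → PtZ m l → Mat n}
  {F : Fin l → PtZ m l → Mat n} {U R : PtZ m l → Mat n}

theorem exists_norm_le_of_genCond (hN : IsOpen N) (hN0 : 0 ∈ N) (hε : 0 < ε)
    (hC : ∀ i, MDiffOn (C i) (ball 0 ε ×ˢ N)) (hF : ∀ α, MDiffOn (F α) (ball 0 ε ×ˢ N))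
    (hU : MDiffOn U (ball 0 ε ×ˢ N))
    (hCC : ∀ p ∈ N, ∀ i j, Commute (C i (0, p)) (C j (0, p)))
    (hCF : ∀ p ∈ N, ∀ i α, Commute (C i (0, p)) (F α (0, p)))
    (hCU : ∀ p ∈ N, ∀ i, Commute (C i (0, p)) (U (0, p)))
    (hFU : ∀ p ∈ N, ∀ α, Commute (F α (0, p)) (U (0, p))) {ζ : Fin n → ℂ}
    (hζ : GenCond (Fin.snoc (fun i => C i (0, 0, 0)) (U (0, 0, 0))) ζ) :
    ∃ δ > 0, ball 0 δ ⊆ N ∧ ∃ K, 0 ≤ K ∧ ∀ p ∈ ball 0 δ, ∀ (X : Mat n) (b : ℝ),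
      (∀ i, ‖(C i (0, p)).transpose * X - X * C i (0, p)‖ ≤ b) →
      ‖(U (0, p)).transpose * X - X * U (0, p)‖ ≤ b →
      ∀ α, ‖(F α (0, p)).transpose * X - X * F α (0, p)‖ ≤ K * b := by
  let B : Fin (m + 1) → (Fin m → ℂ) × (Fin l → ℂ) → Mat n := fun i p =>
    Fin.snoc (α := fun _ => Mat n) (fun i => C i (0, p)) (U (0, p)) i
  have hBC : ∀ i p, B (Fin.castSucc i) p = C i (0, p) := fun i p => Fin.snoc_castSucc ..
  have hBU : ∀ p, B (Fin.last m) p = U (0, p) := fun p => Fin.snoc_last ..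
  have hcont : ∀ {A : PtZ m l → Mat n}, MDiffOn A (ball 0 ε ×ˢ N) →
      ContinuousAt (fun p => A (0, p)) 0 := fun {A} hA => by
    have h := ((mDiffOn_iff_differentiableOn.1 hA).differentiableAt
      (x := ((0 : ℂ), (0 : (Fin m → ℂ) × (Fin l → ℂ))))
      ((isOpen_ball.prod hN).mem_nhds ⟨mem_ball_self hε, hN0⟩)).continuousAt
    exact h.comp (f := fun p => ((0 : ℂ), p)) (by fun_prop)
  have hB : ∀ i, ContinuousAt (B i) 0 := by
    intro i
    induction i using Fin.lastCases with
    | last => exact (hcont hU).congr (.of_forall fun p => (hBU p).symm)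
    | cast i => exact (hcont (hC i)).congr (.of_forall fun p => (hBC i p).symm)
  have hcomm : ∀ᶠ p in 𝓝 0, ∀ i j, Commute (B i p) (B j p) := by
    filter_upwards [hN.mem_nhds hN0] with p hp i j
    induction i using Fin.lastCases with
    | last =>
      induction j using Fin.lastCases with
      | last => exact Commute.refl _
      | cast j => simpa only [hBC, hBU] using (hCU p hp j).symm
    | cast i =>
      induction j using Fin.lastCases with
      | last => simpa only [hBC, hBU] using hCU p hp i
      | cast j => simpa only [hBC] using hCC p hp i j
  have hcommF : ∀ α, ∀ᶠ p in 𝓝 0, ∀ i, Commute (F α (0, p)) (B i p) := by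
    intro α
    filter_upwards [hN.mem_nhds hN0] with p hp i
    induction i using Fin.lastCases with
    | last => simpa only [hBU] using hFU p hp α
    | cast i => simpa only [hBC] using (hCF p hp i α).symm
  choose K hK0 hK using fun α =>
    exists_eventually_norm_le_of_genCond hB (hcont (hF α)) hcomm (hcommF α) hζ
  obtain ⟨δ, hδ, hball⟩ := Metric.eventually_nhds_iff_ball.1
    ((hN.eventually_mem hN0).and (eventually_all.2 hK))
  refine ⟨δ, hδ, fun p hp => (hball p hp).1, ∑ α, K α, Finset.sum_nonneg fun α _ => hK0 α,
    fun p hp X b hCX hUX α => ?_⟩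
  have hBX : ∀ i, ‖(B i p).transpose * X - X * B i p‖ ≤ b := by
    intro i
    induction i using Fin.lastCases with
    | last => simpa only [hBU] using hUX
    | cast i => simpa only [hBC] using hCX i
  exact ((hball p hp).2 α X b hBX).trans (mul_le_mul_of_nonneg_right
    (Finset.single_le_sum (fun α _ => hK0 α) (Finset.mem_univ α)) ((norm_nonneg _).trans hUX))

theorem exists_ball_gram_extension {w : ℤ} (hε : 0 < ε) (hN : IsOpen N) (hN0 : 0 ∈ N)
    (hC : ∀ i, MDiffOn (C i) (ball 0 ε ×ˢ N)) (hF : ∀ α, MDiffOn (F α) (ball 0 ε ×ˢ N))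
    (hU : MDiffOn U (ball 0 ε ×ˢ N))
    (hCC : ∀ p ∈ N, ∀ i j, Commute (C i (0, p)) (C j (0, p)))
    (hCF : ∀ p ∈ N, ∀ i α, Commute (C i (0, p)) (F α (0, p)))
    (hCU : ∀ p ∈ N, ∀ i, Commute (C i (0, p)) (U (0, p)))
    (hFU : ∀ p ∈ N, ∀ α, Commute (F α (0, p)) (U (0, p))) {ζ : Fin n → ℂ}
    (hζ : GenCond (Fin.snoc (fun i => C i (0, 0, 0)) (U (0, 0, 0))) ζ)
    (hR : MDiffOn R ((ball (0 : ℂ) ε \ {0}) ×ˢ N))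
    (hRz : ∀ z ∈ ball (0 : ℂ) ε, z ≠ 0 → ∀ p ∈ N, z • mpderiv R (z, p) (1, 0, 0) =
      z⁻¹ • ((U (z, p)).transpose * R (z, p) - R (z, p) * U (-z, p)))
    (hRt : ∀ z ∈ ball (0 : ℂ) ε, z ≠ 0 → ∀ p ∈ N, ∀ i, mpderiv R (z, p) (0, Pi.single i 1, 0) =
      z⁻¹ • ((C i (z, p)).transpose * R (z, p) - R (z, p) * C i (-z, p)))
    (hRy : ∀ z ∈ ball (0 : ℂ) ε, z ≠ 0 → ∀ p ∈ N, ∀ α, mpderiv R (z, p) (0, 0, Pi.single α 1) =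
      z⁻¹ • ((F α (z, p)).transpose * R (z, p) - R (z, p) * F α (-z, p)))
    (hext : ∀ t, (t, 0) ∈ N → ∃ g : ℂ → Mat n, MDiffOn g (ball 0 ε) ∧
      ∀ z ∈ ball (0 : ℂ) ε, z ≠ 0 → g z = z ^ (-w) • R (z, t, 0)) :
    ∃ δ > 0, ball 0 δ ⊆ N ∧
      ∃ Rhat : PtZ m l → Mat n, MDiffOn Rhat (ball 0 (ε / 2) ×ˢ ball 0 δ) ∧
        ∀ z ∈ ball (0 : ℂ) (ε / 2), ∀ p ∈ ball 0 δ, z ≠ 0 →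
          Rhat (z, p) = z ^ (-w) • R (z, p) := by
  obtain ⟨δ, hδ, hball, K, hK0, hK⟩ :=
    exists_norm_le_of_genCond hN hN0 hε hC hF hU hCC hCF hCU hFU hζ
  have hsub : ∀ {s : Set ℂ} {A : PtZ m l → Mat n}, MDiffOn A (s ×ˢ N) →
      DifferentiableOn ℂ A (s ×ˢ ball 0 δ) := fun h =>
    (mDiffOn_iff_differentiableOn.1 h).mono (prod_mono_right hball)
  have hRd : ∀ z ∈ ball (0 : ℂ) ε, z ≠ 0 → ∀ p ∈ ball 0 δ, ∀ v,
      mpderiv R (z, p) v = fderiv ℂ R (z, p) v := fun z hz hz0 p hp =>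
    mpderiv_eq_fderiv ((hsub hR).differentiableAt
      (((isOpen_ball.sdiff isClosed_singleton).prod isOpen_ball).mem_nhds ⟨⟨hz, hz0⟩, hp⟩))
  have hT : IsBoundedLinearMap ℂ (Matrix.transpose : Mat n → Mat n) :=
    ((⟨(Matrix.transposeLinearEquiv (Fin n) (Fin n) ℂ ℂ).toLinearMap,
      continuous_id.matrix_transpose⟩ : Mat n →L[ℂ] Mat n)).isBoundedLinearMap
  have : CompleteSpace (Mat n) := FiniteDimensional.complete ℂ _
  obtain ⟨Rhat, hd, he⟩ := exists_gram_extension (V := Mat n) (w := w) hT hε hK0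
    (fun i => hsub (hC i)) (fun α => hsub (hF α)) (hsub hU) hK (hsub hR)
    (fun z hz hz0 p hp =>
      (congrArg (z • ·) (hRd z hz hz0 p hp _)).symm.trans (hRz z hz hz0 p (hball hp)))
    (fun z hz hz0 p hp i => (hRd z hz hz0 p hp _).symm.trans (hRt z hz hz0 p (hball hp) i))
    (fun z hz hz0 p hp α => (hRd z hz hz0 p hp _).symm.trans (hRy z hz hz0 p (hball hp) α))
    (fun t ht => (hext t (hball ht)).imp fun f hf =>
      ⟨mDiffOn_iff_differentiableOn.1 hf.1, hf.2⟩)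
  exact ⟨δ, hδ, hball, Rhat, mDiffOn_iff_differentiableOn.2 hd, he⟩

end Extension

end Generation

end HolomorphicExtension

theorem stmt_5
    (w : ℤ) (n m l : ℕ) (hn : 0 < n)
    (ε : ℝ) (hε : 0 < ε)
    (N : Set ((Fin m → ℂ) × (Fin l → ℂ))) (hNopen : IsOpen N)
    (hNconn : IsConnected N) (hN0 : (0 : (Fin m → ℂ) × (Fin l → ℂ)) ∈ N)
    (C : Fin m → PtZ m l → Mat n) (F : Fin l → PtZ m l → Mat n)
    (U : PtZ m l → Mat n)
    (hCd : ∀ i, MDiffOn (C i) (Metric.ball (0 : ℂ) ε ×ˢ N))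
    (hFd : ∀ α, MDiffOn (F α) (Metric.ball (0 : ℂ) ε ×ˢ N))
    (hUd : MDiffOn U (Metric.ball (0 : ℂ) ε ×ˢ N))
    -- the matrices at z = 0 pairwise commute
    (hcomm : ∀ p ∈ N,
      (∀ i j, matComm (C i (0, p.1, p.2)) (C j (0, p.1, p.2))  = 0) ∧
      (∀ i α, matComm (C i (0, p.1, p.2)) (F α (0, p.1, p.2)) = 0) ∧
      (∀ α β, matComm (F α (0, p.1, p.2)) (F β (0, p.1, p.2)) = 0) ∧
      (∀ i, matComm (C i (0, p.1, p.2)) (U (0, p.1, p.2)) = 0) ∧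
      (∀ α, matComm (F α (0, p.1, p.2)) (U (0, p.1, p.2)) = 0))
    -- generation condition at the origin
    (hGC : ∃ ζ : Fin n → ℂ,
      GenCond (Fin.snoc (fun i => C i (0, 0, 0)) (U (0, 0, 0))) ζ)
    (R : PtZ m l → Mat n)
    (hRd : MDiffOn R ((Metric.ball (0 : ℂ) ε \ {0}) ×ˢ N))
    -- flatness and z-sesquilinearity of the pairing
    (hRz : ∀ z ∈ Metric.ball (0 : ℂ) ε, z ≠ 0 → ∀ p ∈ N,
      z • mpderiv R (z, p.1, p.2) ((1 : ℂ), 0, 0) =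
        z⁻¹ • ((U (z, p.1, p.2)).transpose * R (z, p.1, p.2) -
          R (z, p.1, p.2) * U (-z, p.1, p.2)))
    (hRt : ∀ z ∈ Metric.ball (0 : ℂ) ε, z ≠ 0 → ∀ p ∈ N, ∀ i,
      mpderiv R (z, p.1, p.2) ((0 : ℂ), Pi.single i 1, 0) =
        z⁻¹ • ((C i (z, p.1, p.2)).transpose * R (z, p.1, p.2) -
          R (z, p.1, p.2) * C i (-z, p.1, p.2)))
    (hRy : ∀ z ∈ Metric.ball (0 : ℂ) ε, z ≠ 0 → ∀ p ∈ N, ∀ α,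
      mpderiv R (z, p.1, p.2) ((0 : ℂ), 0, Pi.single α 1) =
        z⁻¹ • ((F α (z, p.1, p.2)).transpose * R (z, p.1, p.2) -
          R (z, p.1, p.2) * F α (-z, p.1, p.2)))
    -- at y = 0, z^{-w} R extends holomorphically across z = 0
    (hext : ∀ t : Fin m → ℂ, ((t, 0) : (Fin m → ℂ) × (Fin l → ℂ)) ∈ N →
      ∃ g : ℂ → Mat n, MDiffOn g (Metric.ball (0 : ℂ) ε) ∧
        ∀ z ∈ Metric.ball (0 : ℂ) ε, z ≠ 0 →
          g z = (z ^ (-w) : ℂ) • R (z, t, 0)) :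
    -- conclusion: z^{-w} R extends holomorphically across z = 0 near the origin
    ∃ ε' : ℝ, 0 < ε' ∧ ε' ≤ ε ∧
      ∃ N' : Set ((Fin m → ℂ) × (Fin l → ℂ)), IsOpen N' ∧
        (0 : (Fin m → ℂ) × (Fin l → ℂ)) ∈ N' ∧ N' ⊆ N ∧
        ∃ Rhat : PtZ m l → Mat n,
          MDiffOn Rhat (Metric.ball (0 : ℂ) ε' ×ˢ N') ∧
          ∀ z ∈ Metric.ball (0 : ℂ) ε', ∀ p ∈ N', z ≠ 0 →
            Rhat (z, p.1, p.2) = (z ^ (-w) : ℂ) • R (z, p.1, p.2) := by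
  obtain ⟨ζ, hζ⟩ := hGC
  have hcomm' : ∀ {A B : Mat n}, matComm A B = 0 → Commute A B := sub_eq_zero.1
  obtain ⟨δ, hδ, hball, Rhat, hRhat, hRhat'⟩ := exists_ball_gram_extension hε hNopen hN0 hCd hFd hUd
    (fun p hp i j => hcomm' ((hcomm p hp).1 i j))
    (fun p hp i α => hcomm' ((hcomm p hp).2.1 i α))
    (fun p hp i => hcomm' ((hcomm p hp).2.2.2.1 i))
    (fun p hp α => hcomm' ((hcomm p hp).2.2.2.2 α)) hζ hRd hRz hRt hRy hext
  exact ⟨ε / 2, half_pos hε, half_le_self hε.le, Metric.ball 0 δ, Metric.isOpen_ball,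
    Metric.mem_ball_self hδ, hball, Rhat, hRhat, hRhat'⟩
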